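/- Let r ≥ 1 be an integer and let N be a positive integer satisfying the three conditions: d_N ≥ e^{11.2}, p_N^{1/2 − 1/log d_N} ≥ 2^r, and (0.655/(π·e))·√(d_N)/log(d_N) ≥ 2^{r(N−1)}. Let D < 0 be a fundamental discriminant with |D| ≥ d_N. If L(s, χ_D) ≠ 0 for all real s with 1 − 1/(4·log|D|) ≤ s < 1, then the exponent E(D) of the class group Cl(D) is not equal to 2^r. -/

import Mathlib

open NumberField

/-- `D` is a fundamental discriminant: either `D ≡ 1 (mod 4)` and `D` is squarefree,
or `D = 4m` for a squarefree integer `m ≡ 2` or `3 (mod 4)`. (We exclude the degenerate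
case `D = 1`, so that `D` is the discriminant of a quadratic number field.) -/
def IsFundamentalDiscriminant (D : ℤ) : Prop :=
  D ≠ 1 ∧ ((D % 4 = 1 ∧ Squarefree D) ∨
    ∃ m : ℤ, D = 4 * m ∧ Squarefree m ∧ (m % 4 = 2 ∨ m % 4 = 3))

/-- `χ` is the Kronecker character attached to the fundamental discriminant `D`: the (unique)
Dirichlet character modulo `|D|` with `χ(p) = (D/p)` (Legendre symbol) for every odd prime
`p ∤ D`. -/
def IsKroneckerChar (D : ℤ) (χ : DirichletCharacter ℂ D.natAbs) : Prop :=
  ∀ (p : ℕ) (hp : p.Prime), p ≠ 2 → ¬ ((p : ℤ) ∣ D) →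
    χ (p : ZMod D.natAbs) = ((@legendreSym p ⟨hp⟩ D : ℤ) : ℂ)

/-- The analytically continued Dirichlet L-function, extended by the junk value `0` for
modulus `0`. -/
noncomputable def LFunc {N : ℕ} (χ : DirichletCharacter ℂ N) (s : ℂ) : ℂ :=
  if h : N = 0 then 0 else
    letI : NeZero N := ⟨h⟩
    DirichletCharacter.LFunction χ s

/-- `d n`: the product of the first `n` prime numbers. -/
noncomputable def primesProd (n : ℕ) : ℕ := ∏ i ∈ Finset.range n, Nat.nth Nat.Prime i

section

open Filter Topology

theorem hasSum_partialSum_mul_sub {𝕜 : Type*} [RCLike 𝕜] {x g : ℕ → 𝕜} {M : ℝ}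
    (hS : ∀ n, ‖∑ i ∈ Finset.range n, x i‖ ≤ M) (hg : Tendsto g atTop (𝓝 0))
    (hd : Summable fun n ↦ ‖g n - g (n + 1)‖) (hx : Summable fun n ↦ x n * g n) :
    HasSum (fun n ↦ (∑ i ∈ Finset.range (n + 1), x i) * (g n - g (n + 1))) (∑' n, x n * g n) := by
  have hsum : Summable fun n ↦ (∑ i ∈ Finset.range (n + 1), x i) * (g n - g (n + 1)) := by
    refine Summable.of_norm_bounded (hd.mul_left M) fun n ↦ ?_
    rw [norm_mul]
    gcongr
    exact hS _
  rw [hsum.hasSum_iff_tendsto_nat]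
  have key : ∀ n, ∑ k ∈ Finset.range n, (∑ i ∈ Finset.range (k + 1), x i) * (g k - g (k + 1)) =
      ∑ k ∈ Finset.range n, x k * g k - (∑ i ∈ Finset.range n, x i) * g n := by
    intro n
    induction n with
    | zero => simp
    | succ n ih =>
      rw [Finset.sum_range_succ, ih, Finset.sum_range_succ (fun k ↦ x k * g k),
        Finset.sum_range_succ x]
      ring
  simp_rw [key]
  have h0 : Tendsto (fun n ↦ (∑ i ∈ Finset.range n, x i) * g n) atTop (𝓝 0) := by
    refine squeeze_zero_norm (a := fun n ↦ M * ‖g n‖) (fun n ↦ ?_) ?_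
    · rw [norm_mul]
      gcongr
      exact hS _
    · simpa using (hg.norm.const_mul M)
  simpa using hx.hasSum.tendsto_sum_nat.sub h0

theorem hasSum_sub_succ_of_tendsto {g : ℕ → ℝ} {l : ℝ} (hanti : Antitone g)
    (hg : Tendsto g atTop (𝓝 l)) : HasSum (fun n ↦ g n - g (n + 1)) (g 0 - l) := by
  rw [hasSum_iff_tendsto_nat_of_nonneg fun n ↦ sub_nonneg.2 (hanti n.le_succ)]
  simp_rw [Finset.sum_range_sub']
  exact hg.const_sub _

theorem norm_sum_range_dirichletCharacter_le {d : ℕ} [NeZero d] {χ : DirichletCharacter ℂ d}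
    (hχ : χ ≠ 1) (n : ℕ) : ‖∑ i ∈ Finset.range n, χ ((i + 1 : ℕ) : ZMod d)‖ ≤ d := by
  have hper : ∀ m, ∑ i ∈ Finset.range d, χ ((m + i + 1 : ℕ) : ZMod d) = 0 := by
    intro m
    rw [← MulChar.sum_eq_zero_of_ne_one hχ]
    refine Finset.sum_bij (fun i _ ↦ ((m + i + 1 : ℕ) : ZMod d)) (fun _ _ ↦ Finset.mem_univ _)
      (fun i hi j hj h ↦ ?_) (fun b _ ↦ ?_) (fun _ _ ↦ rfl)
    · rw [Finset.mem_range] at hi hj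
      have h' : (i : ZMod d) = j := by
        push_cast at h
        exact add_left_cancel (add_right_cancel h)
      rw [ZMod.natCast_eq_natCast_iff] at h'
      exact Nat.ModEq.eq_of_lt_of_lt h' hi hj
    · refine ⟨(b - m - 1).val, Finset.mem_range.2 (ZMod.val_lt _), ?_⟩
      push_cast
      rw [ZMod.natCast_zmod_val]
      ring
  induction n using Nat.strong_induction_on with
  | _ n ih =>
    rcases lt_or_ge n d with h | h
    · refine (norm_sum_le _ _).trans ?_
      refine (Finset.sum_le_card_nsmul _ _ 1 fun i _ ↦ χ.norm_le_one _).trans ?_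
      simpa using h.le
    · obtain ⟨m, rfl⟩ := Nat.exists_eq_add_of_le' h
      rw [Finset.sum_range_add, hper, add_zero]
      exact ih m (Nat.lt_add_of_pos_right (NeZero.pos d))

theorem norm_natCast_cpow_neg_sub_le (n : ℕ) {s : ℂ} (hs : 0 < s.re) :
    ‖((n + 1 : ℕ) : ℂ) ^ (-s) - ((n + 2 : ℕ) : ℂ) ^ (-s)‖ ≤ ‖s‖ * ((n + 1 : ℕ) : ℝ) ^ (-s.re - 1) := by
  have hs0 : s ≠ 0 := by rintro rfl; simp at hs
  have h := (convex_Icc ((n + 1 : ℕ) : ℝ) ((n + 2 : ℕ) : ℝ)).norm_image_sub_le_of_norm_hasDerivWithin_le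
    (f := fun t : ℝ ↦ (t : ℂ) ^ (-s)) (f' := fun t : ℝ ↦ -s * (t : ℂ) ^ (-s - 1))
    (C := ‖s‖ * ((n + 1 : ℕ) : ℝ) ^ (-s.re - 1)) (x := ((n + 2 : ℕ) : ℝ)) (y := ((n + 1 : ℕ) : ℝ))
    ?_ ?_ ?_ ?_
  · norm_num at h ⊢
    exact h
  · intro t ht
    have h0 : 0 < t := lt_of_lt_of_le (by positivity) ht.1
    exact (hasDerivAt_ofReal_cpow_const h0.ne' (neg_ne_zero.2 hs0)).hasDerivWithinAt
  · intro t ht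
    have h0 : 0 < t := lt_of_lt_of_le (by positivity) ht.1
    rw [norm_mul, norm_neg, Complex.norm_cpow_eq_rpow_re_of_pos h0]
    have : (-s - 1).re = -s.re - 1 := by simp
    rw [this]
    gcongr ?_ * ?_
    exact Real.rpow_le_rpow_of_nonpos (by positivity) ht.1 (by linarith)
  · simp
  · simp

theorem hasSum_LFunction_of_re_pos {d : ℕ} [NeZero d] {χ : DirichletCharacter ℂ d}
    (hχ : χ ≠ 1) {s : ℂ} (hs : 0 < s.re) :
    HasSum (fun n : ℕ ↦ (∑ i ∈ Finset.range (n + 1), χ ((i + 1 : ℕ) : ZMod d)) *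
      (((n + 1 : ℕ) : ℂ) ^ (-s) - ((n + 2 : ℕ) : ℂ) ^ (-s))) (χ.LFunction s) := by
  set A : ℕ → ℂ := fun n ↦ ∑ i ∈ Finset.range (n + 1), χ ((i + 1 : ℕ) : ZMod d) with hA
  set F : ℕ → ℂ → ℂ := fun n s ↦ A n *
      (((n + 1 : ℕ) : ℂ) ^ (-s) - ((n + 2 : ℕ) : ℂ) ^ (-s)) with hF
  have hFle : ∀ n (s : ℂ), 0 < s.re → ‖F n s‖ ≤ d * (‖s‖ * ((n + 1 : ℕ) : ℝ) ^ (-s.re - 1)) := by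
    intro n s hs
    rw [hF, norm_mul]
    gcongr
    · exact norm_sum_range_dirichletCharacter_le hχ _
    · exact norm_natCast_cpow_neg_sub_le n hs
  have hsumm : ∀ σ : ℝ, 0 < σ → Summable fun n : ℕ ↦ ((n + 1 : ℕ) : ℝ) ^ (-σ - 1) := by
    intro σ hσ
    exact (summable_nat_add_iff 1).2 (Real.summable_nat_rpow.2 (by linarith))
  have hsum : ∀ s : ℂ, 0 < s.re → Summable fun n ↦ F n s := fun s hs ↦
    Summable.of_norm_bounded (((hsumm _ hs).mul_left _).mul_left _) fun n ↦ hFle n s hs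
  have hdiff : DifferentiableOn ℂ (fun s ↦ ∑' n, F n s) {s : ℂ | 0 < s.re} := by
    intro s₀ hs₀
    have hs₀' : 0 < s₀.re := hs₀
    set U : Set ℂ := {s : ℂ | s₀.re / 2 < s.re} ∩ Metric.ball 0 (‖s₀‖ + 1) with hU
    have hUo : IsOpen U := (isOpen_lt continuous_const Complex.continuous_re).inter Metric.isOpen_ball
    have hmem : s₀ ∈ U := ⟨by simp only [Set.mem_ofPred_eq]; linarith, by simp⟩
    have h := Complex.differentiableOn_tsum_of_summable_norm (F := F) (U := U)
      (u := fun n : ℕ ↦ d * ((‖s₀‖ + 1) * ((n + 1 : ℕ) : ℝ) ^ (-(s₀.re / 2) - 1)))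
      (((hsumm _ (by linarith)).mul_left _).mul_left _) ?_ hUo ?_
    · exact (h.differentiableAt (hUo.mem_nhds hmem)).differentiableWithinAt
    · intro n
      refine Differentiable.differentiableOn ?_
      refine (Differentiable.sub ?_ ?_).const_mul _
      · exact (differentiable_id.neg).const_cpow (Or.inl (Nat.cast_ne_zero.2 n.succ_ne_zero))
      · exact (differentiable_id.neg).const_cpow (Or.inl (Nat.cast_ne_zero.2 (by omega)))
    · intro n w hw
      have hw1 : s₀.re / 2 < w.re := hw.1
      have hw2 : ‖w‖ < ‖s₀‖ + 1 := by simpa using hw.2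
      refine (hFle n w (by linarith)).trans ?_
      gcongr
      · exact_mod_cast Nat.succ_le_succ (Nat.zero_le n)
  have hopen : IsOpen {s : ℂ | 0 < s.re} := isOpen_lt continuous_const Complex.continuous_re
  have heq : Set.EqOn (fun s ↦ ∑' n, F n s) χ.LFunction {s : ℂ | 0 < s.re} := by
    refine AnalyticOnNhd.eqOn_of_preconnected_of_eventuallyEq (z₀ := 2) (hdiff.analyticOnNhd hopen)
      ((DirichletCharacter.differentiable_LFunction hχ).differentiableOn.analyticOnNhd hopen)
      (convex_halfSpace_re_gt 0).isPreconnected (by simp) ?_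
    have hn : {s : ℂ | 1 < s.re} ∈ 𝓝 (2 : ℂ) :=
      (isOpen_lt continuous_const Complex.continuous_re).mem_nhds (by simp)
    filter_upwards [hn] with s hs
    have hs : 1 < s.re := hs
    have hLs := χ.LSeriesSummable_of_one_lt_re hs
    have hterm : ∀ n : ℕ, LSeries.term (fun x ↦ χ x) s (n + 1) =
        χ ((n + 1 : ℕ) : ZMod d) * ((n + 1 : ℕ) : ℂ) ^ (-s) := by
      intro n
      rw [LSeries.term_of_ne_zero n.succ_ne_zero, Complex.cpow_neg, div_eq_mul_inv]
    have hx : Summable fun n : ℕ ↦ χ ((n + 1 : ℕ) : ZMod d) * ((n + 1 : ℕ) : ℂ) ^ (-s) := by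
      simp_rw [← hterm]
      exact (summable_nat_add_iff 1).2 hLs
    have hab := hasSum_partialSum_mul_sub (norm_sum_range_dirichletCharacter_le hχ)
      (g := fun n : ℕ ↦ ((n + 1 : ℕ) : ℂ) ^ (-s)) ?_ ?_ hx
    · rw [χ.LFunction_eq_LSeries hs]
      refine hab.tsum_eq.trans ?_
      simp_rw [← hterm]
      rw [LSeries, hLs.tsum_eq_zero_add]
      simp
    · rw [tendsto_zero_iff_norm_tendsto_zero]
      have : Tendsto (fun n : ℕ ↦ ((n + 1 : ℕ) : ℝ) ^ (-s.re)) atTop (𝓝 0) :=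
        (tendsto_rpow_neg_atTop (by linarith)).comp
          (tendsto_natCast_atTop_atTop.comp (tendsto_add_atTop_nat 1))
      refine this.congr fun n ↦ ?_
      rw [Complex.norm_natCast_cpow_of_pos n.succ_pos, Complex.neg_re]
    · exact Summable.of_nonneg_of_le (fun _ ↦ norm_nonneg _)
        (fun n ↦ norm_natCast_cpow_neg_sub_le n (by linarith)) ((hsumm _ (by linarith)).mul_left _)
  have := (hsum s hs).hasSum
  rwa [show ∑' n, F n s = χ.LFunction s from heq hs] at this

end

section

open Filter Topology MeasureTheory

/-- The function `u ↦ 1 / (e ^ u - 1) - 1 / u`. -/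
noncomputable def lambertKernel (u : ℝ) : ℝ := 1 / (Real.exp u - 1) - 1 / u

theorem exp_sub_one_pos {u : ℝ} (hu : 0 < u) : 0 < Real.exp u - 1 := by
  linarith [Real.add_one_lt_exp hu.ne']

theorem lambertKernel_nonpos {u : ℝ} (hu : 0 < u) : lambertKernel u ≤ 0 := by
  rw [lambertKernel, sub_nonpos]
  exact one_div_le_one_div_of_le hu (by linarith [Real.add_one_le_exp u])

theorem neg_one_le_lambertKernel {u : ℝ} (hu : 0 < u) : -1 ≤ lambertKernel u := by
  have h1 := exp_sub_one_pos hu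
  have h2 := Real.one_sub_le_exp_neg u
  rw [Real.exp_neg] at h2
  have h3 : (1 - u) * Real.exp u ≤ 1 := by
    calc (1 - u) * Real.exp u ≤ (Real.exp u)⁻¹ * Real.exp u := by gcongr
      _ = 1 := inv_mul_cancel₀ (Real.exp_pos u).ne'
  have h4 : 1 / u ≤ 1 / (Real.exp u - 1) + 1 := by
    rw [div_add_one h1.ne', div_le_div_iff₀ hu h1]
    nlinarith
  rw [lambertKernel]
  linarith

theorem neg_one_div_le_lambertKernel {u : ℝ} (hu : 0 < u) : -(1 / u) ≤ lambertKernel u := by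
  have h1 := exp_sub_one_pos hu
  have : 0 ≤ 1 / (Real.exp u - 1) := by positivity
  rw [lambertKernel]
  linarith

theorem continuousOn_lambertKernel : ContinuousOn lambertKernel (Set.Ioi 0) := by
  refine ContinuousOn.sub (ContinuousOn.div continuousOn_const
    (Real.continuous_exp.continuousOn.sub continuousOn_const) fun u hu ↦ ?_)
    (ContinuousOn.div continuousOn_const continuousOn_id fun u hu ↦ (ne_of_gt hu))
  exact (exp_sub_one_pos hu).ne'

theorem monotoneOn_lambertKernel : MonotoneOn lambertKernel (Set.Ioi 0) := by
  have hderiv : ∀ u : ℝ, 0 < u →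
      HasDerivAt lambertKernel (-Real.exp u / (Real.exp u - 1) ^ 2 - -1 / u ^ 2) u := by
    intro u hu
    have h1 := ((Real.hasDerivAt_exp u).sub_const 1).inv (exp_sub_one_pos hu).ne'
    have h2 := (hasDerivAt_id u).inv hu.ne'
    have h3 := h1.sub h2
    refine h3.congr_of_eventuallyEq (Eventually.of_forall fun v ↦ ?_)
    simp [lambertKernel]
  refine monotoneOn_of_deriv_nonneg (convex_Ioi 0) continuousOn_lambertKernel ?_ ?_
  · intro u hu
    rw [interior_Ioi] at hu
    exact (hderiv u hu).differentiableAt.differentiableWithinAt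
  · intro u hu
    rw [interior_Ioi] at hu
    have hu : 0 < u := hu
    rw [(hderiv u hu).deriv]
    have h1 := exp_sub_one_pos hu
    have h2 : u / 2 ≤ Real.sinh (u / 2) := Real.self_le_sinh_iff.2 (by linarith)
    have h3 : Real.exp u - 1 = 2 * Real.sinh (u / 2) * Real.exp (u / 2) := by
      rw [Real.sinh_eq, show u = u / 2 + u / 2 by ring, Real.exp_add, Real.exp_neg]
      have := Real.exp_pos (u / 2)
      field_simp
      ring_nf
    have h4 : Real.exp u = Real.exp (u / 2) ^ 2 := by
      rw [← Real.exp_nat_mul]; congr 1; push_cast; ring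
    have h5 : Real.exp u * u ^ 2 ≤ (Real.exp u - 1) ^ 2 := by
      rw [h3, h4, mul_pow, mul_comm]
      gcongr
      linarith
    have h6 : Real.exp u / (Real.exp u - 1) ^ 2 ≤ 1 / u ^ 2 := by
      rw [div_le_div_iff₀ (by positivity) (by positivity)]
      linarith
    rw [neg_div, neg_div]
    linarith

theorem integrableOn_lambertKernel_mul_rpow {β : ℝ} (h0 : 0 < β) (h1 : β < 1) :
    IntegrableOn (fun t ↦ lambertKernel t * t ^ (β - 1)) (Set.Ioi 0) := by
  have hcont : ContinuousOn (fun t ↦ lambertKernel t * t ^ (β - 1)) (Set.Ioi 0) :=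
    continuousOn_lambertKernel.mul (continuousOn_id.rpow_const fun t ht ↦ Or.inl (ne_of_gt ht))
  rw [← Set.Ioc_union_Ioi_eq_Ioi zero_le_one]
  refine IntegrableOn.union ?_ ?_
  · have h : IntegrableOn (fun t : ℝ ↦ t ^ (β - 1)) (Set.Ioc 0 1) := by
      rw [← intervalIntegrable_iff_integrableOn_Ioc_of_le zero_le_one]
      exact intervalIntegral.intervalIntegrable_rpow' (by linarith)
    refine h.mono' ((hcont.mono Set.Ioc_subset_Ioi_self).aestronglyMeasurable measurableSet_Ioc) ?_
    filter_upwards [ae_restrict_mem measurableSet_Ioc] with t ht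
    have := Real.rpow_nonneg ht.1.le (β - 1)
    rw [norm_mul, Real.norm_of_nonneg this, Real.norm_of_nonpos (lambertKernel_nonpos ht.1)]
    nlinarith [neg_one_le_lambertKernel ht.1]
  · have h : IntegrableOn (fun t : ℝ ↦ t ^ (β - 2)) (Set.Ioi 1) :=
      integrableOn_Ioi_rpow_of_lt (by linarith) one_pos
    refine h.mono' ((hcont.mono (Set.Ioi_subset_Ioi zero_le_one)).aestronglyMeasurable
      measurableSet_Ioi) ?_
    filter_upwards [ae_restrict_mem measurableSet_Ioi] with t ht
    have ht0 : 0 < t := lt_trans one_pos ht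
    have := Real.rpow_nonneg ht0.le (β - 1)
    have h2 : t ^ (β - 2) = t ^ (β - 1) * (1 / t) := by
      rw [show β - 2 = (β - 1) - 1 by ring, Real.rpow_sub_one ht0.ne', div_eq_mul_one_div]
    rw [norm_mul, Real.norm_of_nonneg this, Real.norm_of_nonpos (lambertKernel_nonpos ht0),
      h2, mul_comm]
    exact mul_le_mul_of_nonneg_left (by linarith [neg_one_div_le_lambertKernel ht0]) this

theorem lambertKernel_comp_mul_rpow {β c t : ℝ} (hc : 0 < c) (ht : 0 < t) :
    lambertKernel (c * t) * t ^ (β - 1) =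
      c ^ (1 - β) * (lambertKernel (c * t) * (c * t) ^ (β - 1)) := by
  rw [Real.mul_rpow hc.le ht.le]
  have : c ^ (1 - β) * c ^ (β - 1) = 1 := by
    rw [← Real.rpow_add hc]; simp
  linear_combination (-lambertKernel (c * t) * t ^ (β - 1)) * this

theorem integrableOn_lambertKernel_comp_mul_rpow {β c : ℝ} (h0 : 0 < β) (h1 : β < 1) (hc : 0 < c) :
    IntegrableOn (fun t ↦ lambertKernel (c * t) * t ^ (β - 1)) (Set.Ioi 0) := by
  have h := (integrableOn_Ioi_comp_mul_left_iff
    (fun t ↦ lambertKernel t * t ^ (β - 1)) 0 hc).2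
    (by simpa using integrableOn_lambertKernel_mul_rpow h0 h1)
  refine IntegrableOn.congr_fun (h.const_mul (c ^ (1 - β))) (fun t ht ↦ ?_) measurableSet_Ioi
  exact (lambertKernel_comp_mul_rpow hc ht).symm

theorem integral_lambertKernel_comp_mul_rpow {β c : ℝ} (hc : 0 < c) :
    ∫ t in Set.Ioi 0, lambertKernel (c * t) * t ^ (β - 1) =
      c ^ (-β) * ∫ t in Set.Ioi 0, lambertKernel t * t ^ (β - 1) := by
  rw [setIntegral_congr_fun measurableSet_Ioi
    fun t ht ↦ lambertKernel_comp_mul_rpow (β := β) hc ht, integral_const_mul,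
    integral_comp_mul_left_Ioi (fun t ↦ lambertKernel t * t ^ (β - 1)) 0 hc, mul_zero, smul_eq_mul,
    ← mul_assoc, ← Real.rpow_neg_one, ← Real.rpow_add hc]
  congr 2
  ring

end

section

open Filter Topology MeasureTheory

theorem tendsto_lambertKernel_atTop : Tendsto lambertKernel atTop (𝓝 0) := by
  have h : Tendsto (fun u : ℝ ↦ -(1 / u)) atTop (𝓝 0) := by
    simpa using (tendsto_inv_atTop_zero (𝕜 := ℝ)).neg
  refine tendsto_of_tendsto_of_tendsto_of_le_of_le' h tendsto_const_nhds ?_ ?_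
  · filter_upwards [eventually_gt_atTop 0] with u hu using neg_one_div_le_lambertKernel hu
  · filter_upwards [eventually_gt_atTop 0] with u hu using lambertKernel_nonpos hu

theorem tendsto_natCast_add_one_mul_atTop {t : ℝ} (ht : 0 < t) :
    Tendsto (fun n : ℕ ↦ ((n + 1 : ℕ) : ℝ) * t) atTop atTop :=
  (tendsto_natCast_atTop_atTop.comp (tendsto_add_atTop_nat 1)).atTop_mul_const ht

theorem monotone_lambertKernel_natCast_mul {t : ℝ} (ht : 0 < t) :
    Monotone fun n : ℕ ↦ lambertKernel (((n + 1 : ℕ) : ℝ) * t) := by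
  refine fun m n hmn ↦ monotoneOn_lambertKernel (Set.mem_Ioi.2 (by positivity))
    (Set.mem_Ioi.2 (by positivity)) ?_
  gcongr

theorem hasSum_lambertKernel_sub {t : ℝ} (ht : 0 < t) :
    HasSum (fun n : ℕ ↦ lambertKernel (((n + 2 : ℕ) : ℝ) * t) -
      lambertKernel (((n + 1 : ℕ) : ℝ) * t)) (-lambertKernel t) := by
  have h := hasSum_sub_succ_of_tendsto (g := fun n : ℕ ↦ -lambertKernel (((n + 1 : ℕ) : ℝ) * t))
    (l := 0) (monotone_lambertKernel_natCast_mul ht).neg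
    (by simpa using (tendsto_lambertKernel_atTop.comp (tendsto_natCast_add_one_mul_atTop ht)).neg)
  convert h using 1
  · funext n
    ring
  · simp

/-- The sum obtained from `∑ x n * lambertKernel ((n + 1) * t)` by summation by parts. -/
noncomputable def lambertSum (x : ℕ → ℝ) (t : ℝ) : ℝ :=
  ∑' n : ℕ, (∑ i ∈ Finset.range (n + 1), x i) *
    (lambertKernel (((n + 1 : ℕ) : ℝ) * t) - lambertKernel (((n + 2 : ℕ) : ℝ) * t))

section

variable {x : ℕ → ℝ} {M : ℝ}

theorem norm_partialSum_mul_lambertKernel_sub_le (hS : ∀ n, ‖∑ i ∈ Finset.range n, x i‖ ≤ M) {t : ℝ} (ht : 0 < t)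
    (n : ℕ) :
    ‖(∑ i ∈ Finset.range (n + 1), x i) *
      (lambertKernel (((n + 1 : ℕ) : ℝ) * t) - lambertKernel (((n + 2 : ℕ) : ℝ) * t))‖ ≤
    M * (lambertKernel (((n + 2 : ℕ) : ℝ) * t) - lambertKernel (((n + 1 : ℕ) : ℝ) * t)) := by
  have h := monotone_lambertKernel_natCast_mul ht n.le_succ
  have h' : lambertKernel (((n + 1 : ℕ) : ℝ) * t) ≤ lambertKernel (((n + 2 : ℕ) : ℝ) * t) := h
  rw [norm_mul, norm_sub_rev, Real.norm_of_nonneg (sub_nonneg.2 h')]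
  exact mul_le_mul_of_nonneg_right (hS _) (by linarith)

theorem hasSum_lambertSum (hS : ∀ n, ‖∑ i ∈ Finset.range n, x i‖ ≤ M) {t : ℝ} (ht : 0 < t) :
    HasSum (fun n : ℕ ↦ (∑ i ∈ Finset.range (n + 1), x i) *
      (lambertKernel (((n + 1 : ℕ) : ℝ) * t) - lambertKernel (((n + 2 : ℕ) : ℝ) * t)))
      (lambertSum x t) :=
  (Summable.of_norm_bounded ((hasSum_lambertKernel_sub ht).summable.mul_left M)
    (norm_partialSum_mul_lambertKernel_sub_le hS ht)).hasSum

theorem norm_lambertSum_le (hS : ∀ n, ‖∑ i ∈ Finset.range n, x i‖ ≤ M) {t : ℝ} (ht : 0 < t) :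
    ‖lambertSum x t‖ ≤ M * -lambertKernel t := by
  rw [lambertSum]
  exact tsum_of_norm_bounded ((hasSum_lambertKernel_sub ht).mul_left M)
    (norm_partialSum_mul_lambertKernel_sub_le hS ht)

theorem norm_lambertSum_le_bound (hS : ∀ n, ‖∑ i ∈ Finset.range n, x i‖ ≤ M) {t : ℝ} (ht : 0 < t) :
    ‖lambertSum x t‖ ≤ M := by
  have hM : 0 ≤ M := (norm_nonneg _).trans (hS 0)
  nlinarith [norm_lambertSum_le hS ht, neg_one_le_lambertKernel ht]

variable {β : ℝ}

theorem integrableOn_partialSum_mul_lambertKernel (h0 : 0 < β) (h1 : β < 1) (s : ℝ) (n : ℕ) :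
    IntegrableOn (fun t ↦ s * (lambertKernel (((n + 1 : ℕ) : ℝ) * t) -
      lambertKernel (((n + 2 : ℕ) : ℝ) * t)) * t ^ (β - 1)) (Set.Ioi 0) := by
  have := ((integrableOn_lambertKernel_comp_mul_rpow h0 h1
    (c := ((n + 1 : ℕ) : ℝ)) (by positivity)).sub (integrableOn_lambertKernel_comp_mul_rpow h0 h1
    (c := ((n + 2 : ℕ) : ℝ)) (by positivity))).const_mul s
  refine this.congr (ae_of_all _ fun t ↦ ?_)
  simp only [Pi.sub_apply]
  ring

theorem integral_partialSum_mul_lambertKernel (h0 : 0 < β) (h1 : β < 1) (s : ℝ) (n : ℕ) :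
    ∫ t in Set.Ioi 0, s * (lambertKernel (((n + 1 : ℕ) : ℝ) * t) -
      lambertKernel (((n + 2 : ℕ) : ℝ) * t)) * t ^ (β - 1) =
    s * (((n + 1 : ℕ) : ℝ) ^ (-β) - ((n + 2 : ℕ) : ℝ) ^ (-β)) *
      ∫ t in Set.Ioi 0, lambertKernel t * t ^ (β - 1) := by
  have e : ∀ t : ℝ, s * (lambertKernel (((n + 1 : ℕ) : ℝ) * t) -
      lambertKernel (((n + 2 : ℕ) : ℝ) * t)) * t ^ (β - 1) =
      s * (lambertKernel (((n + 1 : ℕ) : ℝ) * t) * t ^ (β - 1) -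
        lambertKernel (((n + 2 : ℕ) : ℝ) * t) * t ^ (β - 1)) := fun t ↦ by ring
  simp_rw [e]
  rw [integral_const_mul, integral_sub
    (integrableOn_lambertKernel_comp_mul_rpow h0 h1 (by positivity))
    (integrableOn_lambertKernel_comp_mul_rpow h0 h1 (by positivity)),
    integral_lambertKernel_comp_mul_rpow (by positivity),
    integral_lambertKernel_comp_mul_rpow (by positivity)]
  ring

theorem integrableOn_lambertSum_mul_rpow (hS : ∀ n, ‖∑ i ∈ Finset.range n, x i‖ ≤ M)
    (h0 : 0 < β) (h1 : β < 1) :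
    IntegrableOn (fun t ↦ lambertSum x t * t ^ (β - 1)) (Set.Ioi 0) := by
  have hb := (integrableOn_lambertKernel_mul_rpow h0 h1).const_mul (-M)
  refine hb.mono' ?_ ?_
  · refine aestronglyMeasurable_of_tendsto_ae atTop
      (f := fun N t ↦ ∑ n ∈ Finset.range N, (∑ i ∈ Finset.range (n + 1), x i) *
        (lambertKernel (((n + 1 : ℕ) : ℝ) * t) - lambertKernel (((n + 2 : ℕ) : ℝ) * t)) *
          t ^ (β - 1)) (fun N ↦ ?_) ?_
    · exact (integrable_finsetSum _ fun n _ ↦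
        integrableOn_partialSum_mul_lambertKernel h0 h1 _ n).aestronglyMeasurable
    · filter_upwards [ae_restrict_mem measurableSet_Ioi] with t ht
      exact ((hasSum_lambertSum hS ht).mul_right _).tendsto_sum_nat
  · filter_upwards [ae_restrict_mem measurableSet_Ioi] with t ht
    rw [norm_mul, Real.norm_of_nonneg (Real.rpow_nonneg (le_of_lt ht) _)]
    have := mul_le_mul_of_nonneg_right (norm_lambertSum_le hS ht)
      (Real.rpow_nonneg (le_of_lt ht) (β - 1))
    linarith

theorem hasSum_integral_lambertSum (hS : ∀ n, ‖∑ i ∈ Finset.range n, x i‖ ≤ M)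
    (h0 : 0 < β) (h1 : β < 1) :
    HasSum (fun n : ℕ ↦ (∑ i ∈ Finset.range (n + 1), x i) *
      (((n + 1 : ℕ) : ℝ) ^ (-β) - ((n + 2 : ℕ) : ℝ) ^ (-β)) *
        ∫ t in Set.Ioi 0, lambertKernel t * t ^ (β - 1))
      (∫ t in Set.Ioi 0, lambertSum x t * t ^ (β - 1)) := by
  have h := hasSum_integral_of_summable_integral_norm
    (F := fun (n : ℕ) (t : ℝ) ↦ (∑ i ∈ Finset.range (n + 1), x i) *
      (lambertKernel (((n + 1 : ℕ) : ℝ) * t) - lambertKernel (((n + 2 : ℕ) : ℝ) * t)) *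
        t ^ (β - 1)) (μ := volume.restrict (Set.Ioi 0))
    (fun n ↦ integrableOn_partialSum_mul_lambertKernel h0 h1 _ n) ?_
  · simp_rw [integral_partialSum_mul_lambertKernel h0 h1] at h
    convert! h using 1
    refine setIntegral_congr_fun (measurableSet_Ioi (a := (0 : ℝ))) fun t ht ↦ ?_
    exact ((hasSum_lambertSum hS ht).mul_right _).tsum_eq.symm
  · have hanti : Antitone fun n : ℕ ↦ ((n + 1 : ℕ) : ℝ) ^ (-β) := by
      intro m n hmn
      exact Real.rpow_le_rpow_of_nonpos (by positivity) (by gcongr) (by linarith)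
    have hlim : Tendsto (fun n : ℕ ↦ ((n + 1 : ℕ) : ℝ) ^ (-β)) atTop (𝓝 0) :=
      (tendsto_rpow_neg_atTop h0).comp
        (tendsto_natCast_atTop_atTop.comp (tendsto_add_atTop_nat 1))
    have hsum := (hasSum_sub_succ_of_tendsto hanti hlim).summable.mul_left
      (-(M * ∫ t in Set.Ioi 0, lambertKernel t * t ^ (β - 1)))
    refine Summable.of_nonneg_of_le (fun n ↦ integral_nonneg fun t ↦ norm_nonneg _)
      (fun n ↦ ?_) hsum
    have hi := (integrableOn_partialSum_mul_lambertKernel h0 h1 (-M) n)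
    have h2 := integral_partialSum_mul_lambertKernel h0 h1 (-M) n
    refine (setIntegral_mono_on
      (integrableOn_partialSum_mul_lambertKernel h0 h1 _ n).norm hi measurableSet_Ioi
      fun t ht ↦ ?_).trans (h2.le.trans_eq ?_)
    · rw [norm_mul, Real.norm_of_nonneg (Real.rpow_nonneg (le_of_lt ht) _)]
      have := mul_le_mul_of_nonneg_right (norm_partialSum_mul_lambertKernel_sub_le hS ht n)
        (Real.rpow_nonneg (le_of_lt ht) (β - 1))
      linarith
    · push_cast
      ring_nf

theorem integral_lambertKernel_mul_rpow_nonpos :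
    ∫ t in Set.Ioi 0, lambertKernel t * t ^ (β - 1) ≤ 0 :=
  setIntegral_nonpos measurableSet_Ioi fun _ ht ↦
    mul_nonpos_of_nonpos_of_nonneg (lambertKernel_nonpos ht) (Real.rpow_nonneg (le_of_lt ht) _)

theorem integral_lambertSum_nonpos (hS : ∀ n, ‖∑ i ∈ Finset.range n, x i‖ ≤ M)
    (h0 : 0 < β) (h1 : β < 1) {l : ℝ} (hl : 0 ≤ l)
    (h : HasSum (fun n : ℕ ↦ (∑ i ∈ Finset.range (n + 1), x i) *
      (((n + 1 : ℕ) : ℝ) ^ (-β) - ((n + 2 : ℕ) : ℝ) ^ (-β))) l) :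
    ∫ t in Set.Ioi 0, lambertSum x t * t ^ (β - 1) ≤ 0 := by
  rw [(hasSum_integral_lambertSum hS h0 h1).unique (h.mul_right _)]
  exact mul_nonpos_of_nonneg_of_nonpos hl integral_lambertKernel_mul_rpow_nonpos

theorem summable_one_div_exp_sub_one {t : ℝ} (ht : 0 < t) :
    Summable fun n : ℕ ↦ 1 / (Real.exp (((n + 1 : ℕ) : ℝ) * t) - 1) := by
  have hq : Summable fun n : ℕ ↦ (1 / (Real.exp t - 1)) * Real.exp (-t) ^ n :=
    (summable_geometric_of_lt_one (Real.exp_pos _).le (by simpa using ht)).mul_left _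
  refine Summable.of_nonneg_of_le (fun n ↦ ?_) (fun n ↦ ?_) hq
  · exact one_div_nonneg.2 (exp_sub_one_pos (by positivity)).le
  · have hx := exp_sub_one_pos ht
    rw [Real.exp_neg, inv_pow, ← Real.exp_nat_mul, ← one_div, one_div_mul_one_div]
    refine one_div_le_one_div_of_le (by positivity) ?_
    have : Real.exp (((n + 1 : ℕ) : ℝ) * t) = Real.exp t * Real.exp (n * t) := by
      rw [← Real.exp_add]; push_cast; ring_nf
    rw [this]
    have : (1 : ℝ) ≤ Real.exp (n * t) := Real.one_le_exp (by positivity)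
    linarith

theorem lambertSum_eq (hS : ∀ n, ‖∑ i ∈ Finset.range n, x i‖ ≤ M) (hx : ∀ n, ‖x n‖ ≤ 1)
    {l : ℝ} (h : HasSum (fun n : ℕ ↦ (∑ i ∈ Finset.range (n + 1), x i) *
      (((n + 1 : ℕ) : ℝ) ^ (-1 : ℝ) - ((n + 2 : ℕ) : ℝ) ^ (-1 : ℝ))) l) {t : ℝ} (ht : 0 < t) :
    lambertSum x t = (∑' n, x n * (1 / (Real.exp (((n + 1 : ℕ) : ℝ) * t) - 1))) - l / t := by
  set g : ℕ → ℝ := fun n ↦ 1 / (Real.exp (((n + 1 : ℕ) : ℝ) * t) - 1) with hg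
  have hgs : Summable g := summable_one_div_exp_sub_one ht
  have hpos : ∀ n, 0 ≤ g n := fun n ↦ one_div_nonneg.2 (exp_sub_one_pos (by positivity)).le
  have hsum : Summable fun n ↦ x n * g n := by
    refine Summable.of_norm_bounded hgs fun n ↦ ?_
    rw [norm_mul, Real.norm_of_nonneg (hpos n)]
    nlinarith [hx n, hpos n]
  have h1 := hasSum_partialSum_mul_sub hS hgs.tendsto_atTop_zero
    ((hgs.sub ((summable_nat_add_iff 1).2 hgs)).norm) hsum
  have h2 := h1.sub (h.mul_right (1 / t))
  rw [(hasSum_lambertSum hS ht).unique (?_ : HasSum _ ((∑' n, x n * g n) - l / t))]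
  rw [mul_one_div] at h2
  convert! h2 using 1
  funext n
  simp only [hg, lambertKernel, Real.rpow_neg_one]
  push_cast
  have : (n : ℝ) + 1 ≠ 0 := by positivity
  have : (n : ℝ) + 2 ≠ 0 := by positivity
  have e : ((n : ℝ) + 1 + 1) = n + 2 := by ring
  rw [e]
  field_simp
  ring

end

end

section

open Filter Topology MeasureTheory

theorem integrableOn_exp_mul_rpow {a β T : ℝ} (ha : 0 < a) (h1 : β < 1) (hT : 0 < T) :
    IntegrableOn (fun t ↦ Real.exp (-(a * t)) * t ^ (β - 1)) (Set.Ioi T) := by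
  have h : IntegrableOn (fun t ↦ T ^ (β - 1) * Real.exp (-a * t)) (Set.Ioi T) :=
    (exp_neg_integrableOn_Ioi T ha).const_mul _
  refine h.mono' (ContinuousOn.aestronglyMeasurable (ContinuousOn.mul (by fun_prop)
    (continuousOn_id.rpow_const fun t ht ↦ Or.inl (lt_trans hT ht).ne')) measurableSet_Ioi) ?_
  filter_upwards [ae_restrict_mem measurableSet_Ioi] with t ht
  have ht0 : 0 < t := lt_trans hT ht
  rw [norm_mul, Real.norm_of_nonneg (Real.exp_pos _).le,
    Real.norm_of_nonneg (Real.rpow_nonneg ht0.le _), mul_comm, neg_mul]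
  gcongr ?_ * _
  exact Real.rpow_le_rpow_of_nonpos hT (le_of_lt ht) (by linarith)

theorem le_rpow_neg {δ t : ℝ} (hδ : 0 ≤ δ) (ht : 0 < t) : 1 + δ - δ * t ≤ t ^ (-δ) := by
  rw [Real.rpow_def_of_pos ht]
  have h1 := Real.add_one_le_exp (Real.log t * -δ)
  have h2 := Real.log_le_sub_one_of_pos ht
  nlinarith

theorem le_integral_exp_mul_rpow {a δ T : ℝ} (ha : 1 ≤ a) (h0 : 0 < δ) (h1 : δ ≤ 1) (hT : 0 < T)
    (hT1 : T ≤ 1) :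
    (1 - (a + 1) * T) / a ≤ ∫ t in Set.Ioi T, Real.exp (-(a * t)) * t ^ ((1 - δ) - 1) := by
  have ha0 : 0 < a := by linarith
  have hint := integrableOn_exp_mul_rpow (β := 1 - δ) ha0 (by linarith) hT
  set G : ℝ → ℝ := fun t ↦ -Real.exp (-(a * t)) * ((1 + δ - δ * t) / a - δ / a ^ 2) with hG
  have hderiv : ∀ t, HasDerivAt G (Real.exp (-(a * t)) * (1 + δ - δ * t)) t := by
    intro t
    have e1 : HasDerivAt (fun t : ℝ ↦ -Real.exp (-(a * t))) (-(Real.exp (-(a * t)) * -(a * 1))) t :=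
      ((((hasDerivAt_id t).const_mul a).neg).exp).neg
    have e2 : HasDerivAt (fun t : ℝ ↦ (1 + δ - δ * t) / a - δ / a ^ 2) (-(δ * 1) / a) t :=
      ((((hasDerivAt_id t).const_mul δ).const_sub (1 + δ)).div_const a).sub_const _
    refine (e1.mul e2).congr_deriv ?_
    field_simp
    ring
  have hlim : Tendsto G atTop (𝓝 0) := by
    have h3 : Tendsto (fun t : ℝ ↦ Real.exp (-(a * t))) atTop (𝓝 0) :=
      Real.tendsto_exp_neg_atTop_nhds_zero.comp (tendsto_id.const_mul_atTop ha0)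
    have h4 : Tendsto (fun t : ℝ ↦ (a * t) * Real.exp (-(a * t))) atTop (𝓝 0) := by
      have := (Real.tendsto_pow_mul_exp_neg_atTop_nhds_zero 1).comp
        ((tendsto_id (α := ℝ) (x := atTop)).const_mul_atTop ha0)
      simpa [Function.comp_def] using this
    have h5 := (h3.mul_const (-((1 + δ) / a - δ / a ^ 2))).add (h4.mul_const (δ / a ^ 2))
    simp only [zero_mul, add_zero] at h5
    refine h5.congr fun t ↦ ?_
    simp only [hG]
    field_simp
    ring
  have hint2 : IntegrableOn (fun t ↦ Real.exp (-(a * t)) * (1 + δ - δ * t)) (Set.Ioi T) := by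
    have i1 := (integrableOn_exp_mul_rpow (β := 1 - δ) ha0 (by linarith) hT)
    have i2 : IntegrableOn (fun t : ℝ ↦ Real.exp (-(a * t))) (Set.Ioi T) := by
      simpa only [neg_mul] using exp_neg_integrableOn_Ioi T ha0
    have i3 : IntegrableOn (fun t : ℝ ↦ t * Real.exp (-(a * t))) (Set.Ioi T) := by
      have := (integrableOn_rpow_mul_exp_neg_mul_rpow (s := 1) (p := 1) (b := a) (by norm_num)
        one_pos ha0).mono_set (Set.Ioi_subset_Ioi hT.le)
      simpa only [Real.rpow_one, neg_mul] using this
    refine ((i2.const_mul (1 + δ)).sub (i3.const_mul δ)).congr (ae_of_all _ fun t ↦ ?_)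
    simp only [Pi.sub_apply]
    ring
  have hval := integral_Ioi_of_hasDerivAt_of_tendsto' (a := T) (fun t _ ↦ hderiv t) hint2 hlim
  refine le_trans ?_ (hval.symm.le.trans (setIntegral_mono_on hint2 hint measurableSet_Ioi
    fun t ht ↦ ?_))
  · simp only [hG]
    have e1 : 1 - a * T ≤ Real.exp (-(a * T)) := Real.one_sub_le_exp_neg _
    have e2 : (1 - δ * T) / a ≤ (1 + δ - δ * T) / a - δ / a ^ 2 := by
      rw [add_sub_right_comm, add_div, add_sub_assoc]
      have : δ / a ^ 2 ≤ δ / a := by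
        apply div_le_div_of_nonneg_left h0.le ha0; nlinarith
      linarith
    have e3 : 0 ≤ (1 - δ * T) / a := by
      apply div_nonneg _ ha0.le; nlinarith
    have e4 : (1 - a * T) * ((1 - δ * T) / a) ≤ Real.exp (-(a * T)) *
        ((1 + δ - δ * T) / a - δ / a ^ 2) := by
      calc _ ≤ Real.exp (-(a * T)) * ((1 - δ * T) / a) := by gcongr
        _ ≤ _ := by gcongr
    have e5 : (1 - (a + 1) * T) / a ≤ (1 - a * T) * ((1 - δ * T) / a) := by
      rw [← mul_div_assoc]
      gcongr
      nlinarith [mul_nonneg (mul_nonneg ha0.le hT.le) (mul_nonneg h0.le hT.le),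
        mul_nonneg (sub_nonneg.2 h1) hT.le]
    linarith
  · have := le_rpow_neg h0.le (lt_trans hT ht)
    have e : (1 - δ) - 1 = -δ := by ring
    rw [e]
    gcongr

theorem mul_rpow_lt_of_partialSum {x : ℕ → ℝ} {M δ T l L : ℝ}
    (hS : ∀ n, ‖∑ i ∈ Finset.range n, x i‖ ≤ M) (hx : ∀ n, ‖x n‖ ≤ 1)
    (h0 : 0 < δ) (h1 : δ < 1) (hT : 0 < T) (hT1 : T ≤ 1) (hl : 0 ≤ l)
    (hβ : HasSum (fun n : ℕ ↦ (∑ i ∈ Finset.range (n + 1), x i) *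
      (((n + 1 : ℕ) : ℝ) ^ (-(1 - δ)) - ((n + 2 : ℕ) : ℝ) ^ (-(1 - δ)))) l)
    (hone : HasSum (fun n : ℕ ↦ (∑ i ∈ Finset.range (n + 1), x i) *
      (((n + 1 : ℕ) : ℝ) ^ (-1 : ℝ) - ((n + 2 : ℕ) : ℝ) ^ (-1 : ℝ))) L)
    (hF : ∀ t : ℝ, 0 < t → ∑ m ∈ Finset.range 5, Real.exp (-(((m : ℝ) + 1) ^ 2 * t)) ≤
      ∑' n, x n * (1 / (Real.exp (((n + 1 : ℕ) : ℝ) * t) - 1))) :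
    ∑ m ∈ Finset.range 5, (1 - (((m : ℝ) + 1) ^ 2 + 1) * T) / ((m : ℝ) + 1) ^ 2 ≤
      L * (T ^ (-δ) / δ) + M * (T ^ (1 - δ) / (1 - δ)) := by
  have hI := integral_lambertSum_nonpos hS (β := 1 - δ) (by linarith) (by linarith) hl hβ
  have hint := integrableOn_lambertSum_mul_rpow hS (β := 1 - δ) (by linarith) (by linarith)
  rw [← Set.Ioc_union_Ioi_eq_Ioi hT.le, setIntegral_union Set.Ioc_disjoint_Ioi_same
    measurableSet_Ioi (hint.mono_set Set.Ioc_subset_Ioi_self)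
    (hint.mono_set (Set.Ioi_subset_Ioi hT.le))] at hI
  have hA : -(M * (T ^ (1 - δ) / (1 - δ))) ≤
      ∫ t in Set.Ioc 0 T, lambertSum x t * t ^ ((1 - δ) - 1) := by
    have i1 : IntegrableOn (fun t : ℝ ↦ -M * t ^ ((1 - δ) - 1)) (Set.Ioc 0 T) := by
      rw [← intervalIntegrable_iff_integrableOn_Ioc_of_le hT.le]
      exact (intervalIntegral.intervalIntegrable_rpow' (by linarith)).const_mul _
    have i2 : ∫ t in Set.Ioc 0 T, -M * t ^ ((1 - δ) - 1) = -(M * (T ^ (1 - δ) / (1 - δ))) := by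
      rw [← intervalIntegral.integral_of_le hT.le, intervalIntegral.integral_const_mul,
        integral_rpow (Or.inl (by linarith))]
      rw [sub_add_cancel, Real.zero_rpow (by linarith)]
      ring
    rw [← i2]
    refine setIntegral_mono_on i1 (hint.mono_set Set.Ioc_subset_Ioi_self) measurableSet_Ioc
      fun t ht ↦ ?_
    gcongr
    · exact Real.rpow_nonneg ht.1.le _
    · exact neg_le_of_abs_le (norm_lambertSum_le_bound hS ht.1)
  have hB : (∑ m ∈ Finset.range 5, (1 - (((m : ℝ) + 1) ^ 2 + 1) * T) / ((m : ℝ) + 1) ^ 2) -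
      L * (T ^ (-δ) / δ) ≤ ∫ t in Set.Ioi T, lambertSum x t * t ^ ((1 - δ) - 1) := by
    have i1 : ∀ m : ℕ, IntegrableOn (fun t ↦ Real.exp (-(((m : ℝ) + 1) ^ 2 * t)) *
        t ^ ((1 - δ) - 1)) (Set.Ioi T) := fun m ↦
      integrableOn_exp_mul_rpow (by positivity) (by linarith) hT
    have i2 : IntegrableOn (fun t : ℝ ↦ L * t ^ (-δ - 1)) (Set.Ioi T) :=
      (integrableOn_Ioi_rpow_of_lt (by linarith) hT).const_mul _
    have i3 : ∫ t in Set.Ioi T, L * t ^ (-δ - 1) = L * (T ^ (-δ) / δ) := by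
      rw [integral_const_mul, integral_Ioi_rpow_of_lt (by linarith) hT, sub_add_cancel,
        neg_div_neg_eq]
    have i4 := integrable_finsetSum (Finset.range 5) fun m _ ↦ i1 m
    calc _ ≤ (∑ m ∈ Finset.range 5, ∫ t in Set.Ioi T, Real.exp (-(((m : ℝ) + 1) ^ 2 * t)) *
        t ^ ((1 - δ) - 1)) - ∫ t in Set.Ioi T, L * t ^ (-δ - 1) := by
          rw [i3]
          gcongr with m
          refine le_integral_exp_mul_rpow ?_ h0 h1.le hT hT1
          have : (0 : ℝ) ≤ m := by positivity
          nlinarith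
      _ = ∫ t in Set.Ioi T, ((∑ m ∈ Finset.range 5, Real.exp (-(((m : ℝ) + 1) ^ 2 * t)) *
        t ^ ((1 - δ) - 1)) - L * t ^ (-δ - 1)) := by
          rw [integral_sub i4 i2, integral_finsetSum _ fun m _ ↦ i1 m]
      _ ≤ _ := by
          refine setIntegral_mono_on (i4.sub i2) (hint.mono_set (Set.Ioi_subset_Ioi hT.le))
            measurableSet_Ioi fun t ht ↦ ?_
          have ht0 : 0 < t := lt_trans hT ht
          rw [lambertSum_eq hS hx hone ht0, ← Finset.sum_mul, sub_mul]
          have e : L / t * t ^ ((1 - δ) - 1) = L * t ^ (-δ - 1) := by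
            rw [Real.rpow_sub_one ht0.ne' (-δ), show (1 - δ) - 1 = -δ by ring]
            ring
          rw [e]
          gcongr
          exact hF t ht0
  linarith

theorem lt_of_partialSum {x : ℕ → ℝ} {M l L : ℝ} (hM : Real.exp 11.2 ≤ M)
    (hS : ∀ n, ‖∑ i ∈ Finset.range n, x i‖ ≤ M) (hx : ∀ n, ‖x n‖ ≤ 1) (hl : 0 ≤ l)
    (hβ : HasSum (fun n : ℕ ↦ (∑ i ∈ Finset.range (n + 1), x i) *
      (((n + 1 : ℕ) : ℝ) ^ (-(1 - 1 / (4 * Real.log M))) -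
        ((n + 2 : ℕ) : ℝ) ^ (-(1 - 1 / (4 * Real.log M))))) l)
    (hone : HasSum (fun n : ℕ ↦ (∑ i ∈ Finset.range (n + 1), x i) *
      (((n + 1 : ℕ) : ℝ) ^ (-1 : ℝ) - ((n + 2 : ℕ) : ℝ) ^ (-1 : ℝ))) L)
    (hF : ∀ t : ℝ, 0 < t → ∑ m ∈ Finset.range 5, Real.exp (-(((m : ℝ) + 1) ^ 2 * t)) ≤
      ∑' n, x n * (1 / (Real.exp (((n + 1 : ℕ) : ℝ) * t) - 1))) :
    0.655 / (Real.exp 1 * Real.log M) < L := by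
  have hM0 : 0 < M := (Real.exp_pos _).trans_le hM
  set ℓ := Real.log M with hℓ
  have hℓ1 : 11.2 ≤ ℓ := (Real.le_log_iff_exp_le hM0).2 hM
  have hMe : M = Real.exp ℓ := (Real.exp_log hM0).symm
  have hδ0 : 0 < 1 / (4 * ℓ) := by positivity
  have hδ1 : 1 / (4 * ℓ) ≤ 1 / 44.8 := one_div_le_one_div_of_le (by norm_num) (by linarith)
  set δ := 1 / (4 * ℓ) with hδ
  have hδℓ : δ * ℓ = 1 / 4 := by rw [hδ]; field_simp
  set T := Real.exp (-(ℓ + 3)) with hTdef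
  have he1 := Real.exp_one_gt_d9
  have hneg1 : Real.exp (-1) ≤ 0.368 := by
    rw [Real.exp_neg, inv_le_comm₀ (Real.exp_pos _) (by norm_num)]
    exact le_trans (by norm_num) he1.le
  have hT0 : 0 < T := Real.exp_pos _
  have hT6 : T ≤ 0.00001 := by
    have : T ≤ Real.exp (-1) ^ 12 := by
      rw [← Real.exp_nat_mul]
      exact Real.exp_le_exp.2 (by push_cast; linarith)
    refine this.trans ((pow_le_pow_left₀ (Real.exp_pos _).le hneg1 12).trans (by norm_num))
  have hneg3 : Real.exp (-3) ≤ 0.0499 := by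
    have : Real.exp (-3) = Real.exp (-1) ^ 3 := by
      rw [← Real.exp_nat_mul]; norm_num
    rw [this]
    refine (pow_le_pow_left₀ (Real.exp_pos _).le hneg1 3).trans (by norm_num)
  have key := mul_rpow_lt_of_partialSum hS hx hδ0 (by linarith) hT0 (by linarith) hl hβ hone hF
  have hY : T ^ (-δ) = Real.exp (1 / 4 + 3 * δ) := by
    rw [hTdef, ← Real.exp_mul]
    congr 1
    linear_combination hδℓ
  have hY1 : T ^ (-δ) ≤ 1.4 := by
    rw [hY]
    have hb := Real.exp_bound' (x := 0.317) (by norm_num) (by norm_num) (n := 4) (by norm_num)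
    refine (Real.exp_le_exp.2 (?_ : 1 / 4 + 3 * δ ≤ 0.317)).trans (hb.trans ?_)
    · norm_num at hδ1 ⊢
      linarith
    · norm_num [Finset.sum_range_succ, Nat.factorial]
  have hMT : M * T = Real.exp (-3) := by
    rw [hMe, hTdef, ← Real.exp_add]; ring_nf
  have hT2 : T ^ (1 - δ) = T * T ^ (-δ) := by
    rw [sub_eq_add_neg, Real.rpow_add hT0, Real.rpow_one]
  have hY0 : 0 < T ^ (-δ) := Real.rpow_pos_of_pos hT0 _
  rw [hT2] at key
  set Y := T ^ (-δ) with hYdef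
  have hsum : 1.4635 ≤ ∑ m ∈ Finset.range 5, (1 - (((m : ℝ) + 1) ^ 2 + 1) * T) / ((m : ℝ) + 1) ^ 2 := by
    norm_num [Finset.sum_range_succ]
    linarith
  have hs2 : M * (T * Y / (1 - δ)) ≤ 0.0511 * Y := by
    have h1δ : 0 < 1 - δ := by norm_num at hδ1; linarith
    rw [← mul_div_assoc, ← mul_assoc, hMT, div_le_iff₀ h1δ, mul_right_comm]
    gcongr
    norm_num at hδ1 ⊢
    nlinarith
  have hs3 : L * (Y / δ) = 4 * ℓ * L * Y := by
    rw [hδ]; field_simp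
  have h5 : 1.4635 - 0.0511 * Y ≤ 4 * ℓ * L * Y := by linarith
  have h6 : 0.99 < 4 * ℓ * L := by
    by_contra! h
    nlinarith
  rw [div_lt_iff₀ (by positivity)]
  nlinarith

end

section

open Filter Topology MeasureTheory

theorem DirichletCharacter.ofReal_re_apply_of_sq_eq_one {d : ℕ} {χ : DirichletCharacter ℂ d}
    (hχ : χ ^ 2 = 1) (a : ZMod d) :
    (((χ a).re : ℝ) : ℂ) = χ a := by
  rcases MulChar.isQuadratic_iff_sq_eq_one.mpr hχ a with h | h | h <;> simp [h]

theorem DirichletCharacter.zetaMul_apply {d : ℕ} (χ : DirichletCharacter ℂ d) (n : ℕ) :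
    χ.zetaMul n = ∑ i ∈ n.divisors, χ (i : ZMod d) := by
  rw [DirichletCharacter.zetaMul, ArithmeticFunction.coe_zeta_mul_apply]
  refine Finset.sum_congr rfl fun i hi ↦ ?_
  simp [toArithmeticFunction, (Nat.pos_of_mem_divisors hi).ne']

theorem one_le_re_zetaMul_sq {d : ℕ} {χ : DirichletCharacter ℂ d} (hχ : χ ^ 2 = 1) {p : ℕ}
    (hp : p.Prime) (k : ℕ) :
    1 ≤ (χ.zetaMul (p ^ (2 * k))).re := by
  simp only [χ.zetaMul_apply, Nat.sum_divisors_prime_pow hp, Nat.cast_pow, map_pow]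
  rcases MulChar.isQuadratic_iff_sq_eq_one.mpr hχ p with h | h | h
  · simp [h, zero_geom_sum]
  · simp [h]
  · simp [h, neg_one_geom_sum]

theorem sum_exp_le_tsum {d : ℕ} {χ : DirichletCharacter ℂ d} (hχ : χ ^ 2 = 1) {t : ℝ} (ht : 0 < t) :
    ∑ m ∈ Finset.range 5, Real.exp (-(((m : ℝ) + 1) ^ 2 * t)) ≤
      ∑' n : ℕ, (χ ((n + 1 : ℕ) : ZMod d)).re *
        (1 / (Real.exp (((n + 1 : ℕ) : ℝ) * t) - 1)) := by
  set r := Real.exp (-t) with hr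
  have hr0 : 0 < r := Real.exp_pos _
  have hr1 : r < 1 := by simpa [hr] using ht
  have hrn : ∀ n : ℕ, r ^ n = Real.exp (-(n * t)) := fun n ↦ by
    rw [hr, ← Real.exp_nat_mul]; ring_nf
  set w : ℕ+ × ℕ+ → ℝ := fun c ↦ (χ ((c.1 : ℕ) : ZMod d)).re * r ^ (c.1 * c.2 : ℕ) with hw
  have hwsum : Summable w := by
    refine Summable.of_norm_bounded (summable_prod_mul_pow (𝕜 := ℝ) 0 (r := r)
      (by rwa [Real.norm_of_nonneg hr0.le])) fun c ↦ ?_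
    rw [norm_mul, pow_zero, Real.norm_of_nonneg (pow_nonneg hr0.le _)]
    gcongr
    exact (Complex.abs_re_le_norm _).trans (χ.norm_le_one _)
  have h1 : HasSum (fun n : ℕ+ ↦ (χ ((n : ℕ) : ZMod d)).re * (1 / (Real.exp ((n : ℕ) * t) - 1)))
      (∑' c, w c) := by
    refine hwsum.hasSum.prod_fiberwise fun n ↦ ?_
    simp only [hw]
    refine HasSum.mul_left _ ?_
    have hn1 : r ^ (n : ℕ) < 1 := pow_lt_one₀ hr0.le hr1 n.ne_zero
    have hg := (hasSum_geometric_of_lt_one (pow_nonneg hr0.le (n : ℕ)) hn1).mul_left (r ^ (n : ℕ))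
    have e : r ^ (n : ℕ) * (1 - r ^ (n : ℕ))⁻¹ = 1 / (Real.exp ((n : ℕ) * t) - 1) := by
      have : 0 < Real.exp ((n : ℕ) * t) - 1 := exp_sub_one_pos (by have := n.pos; positivity)
      have h1 := Real.exp_pos ((n : ℕ) * t)
      rw [hrn, Real.exp_neg]
      field_simp
    rw [e] at hg
    rw [← Equiv.pnatEquivNat.symm.hasSum_iff]
    convert! hg using 1
    funext k
    simp [Equiv.pnatEquivNat, Nat.succPNat, pow_mul, pow_succ']
  have h2 : HasSum (fun n : ℕ+ ↦ (χ.zetaMul n).re * r ^ (n : ℕ)) (∑' c, w c) := by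
    have := (sigmaAntidiagonalEquivProd.hasSum_iff.2 hwsum.hasSum).sigma fun n ↦ hasSum_fintype _
    convert! this using 1
    funext n
    simp only [hw, Function.comp, sigmaAntidiagonalEquivProd, divisorsAntidiagonalFactors,
      PNat.mk_coe, Equiv.coe_fn_mk]
    rw [Finset.sum_coe_sort (n : ℕ).divisorsAntidiagonal
      (fun x ↦ (χ ((x.1 : ℕ) : ZMod d)).re * r ^ (x.1 * x.2 : ℕ)),
      Nat.sum_divisorsAntidiagonal (fun a b ↦ (χ ((a : ℕ) : ZMod d)).re * r ^ (a * b : ℕ)),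
      χ.zetaMul_apply, Complex.re_sum, Finset.sum_mul]
    refine Finset.sum_congr rfl fun i hi ↦ ?_
    rw [Nat.mul_div_cancel' (Nat.dvd_of_mem_divisors hi)]
  rw [← Equiv.pnatEquivNat.symm.hasSum_iff] at h1 h2
  have h3 : HasSum (fun n : ℕ ↦ (χ ((n + 1 : ℕ) : ZMod d)).re *
        (1 / (Real.exp (((n + 1 : ℕ) : ℝ) * t) - 1))) (∑' c, w c) := h1
  have h4 : HasSum (fun n : ℕ ↦ (χ.zetaMul (n + 1)).re * r ^ (n + 1)) (∑' c, w c) := h2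
  rw [h3.tsum_eq]
  have hpos : ∀ n, 0 ≤ (χ.zetaMul n).re := fun n ↦
    (Complex.le_def.1 (DirichletCharacter.zetaMul_nonneg hχ n)).1
  refine le_trans ?_ (sum_le_hasSum {0, 3, 8, 15, 24}
    (fun n _ ↦ mul_nonneg (hpos _) (pow_nonneg hr0.le _)) h4)
  have p2 := one_le_re_zetaMul_sq hχ Nat.prime_two 1
  have p4 := one_le_re_zetaMul_sq hχ Nat.prime_two 2
  have p3 := one_le_re_zetaMul_sq hχ Nat.prime_three 1
  have p5 := one_le_re_zetaMul_sq hχ Nat.prime_five 1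
  have p1 := one_le_re_zetaMul_sq hχ Nat.prime_two 0
  norm_num at p1 p2 p3 p4 p5
  have hm : ∀ {a : ℝ} (n : ℕ), 1 ≤ a → Real.exp (-(n * t)) ≤ a * r ^ n := fun n ha ↦ by
    rw [← hrn]
    exact le_mul_of_one_le_left (pow_nonneg hr0.le _) ha
  have q1 := hm 1 p1
  have q2 := hm 4 p2
  have q3 := hm 9 p3
  have q4 := hm 16 p4
  have q5 := hm 25 p5
  norm_num [Finset.sum_range_succ] at q1 q2 q3 q4 q5 ⊢
  linarith

section

variable {d : ℕ} [NeZero d] {χ : DirichletCharacter ℂ d}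

theorem hasSum_re_LFunction (hχ : χ ^ 2 = 1) (hχ1 : χ ≠ 1) {s : ℝ} (hs : 0 < s) :
    HasSum (fun n : ℕ ↦ (∑ i ∈ Finset.range (n + 1), (χ ((i + 1 : ℕ) : ZMod d)).re) *
      (((n + 1 : ℕ) : ℝ) ^ (-s) - ((n + 2 : ℕ) : ℝ) ^ (-s))) (χ.LFunction s).re ∧
    (χ.LFunction s).im = 0 := by
  have h := hasSum_LFunction_of_re_pos hχ1 (s := (s : ℂ)) (by simpa using hs)
  have e : ∀ n : ℕ, (∑ i ∈ Finset.range (n + 1), χ ((i + 1 : ℕ) : ZMod d)) *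
      (((n + 1 : ℕ) : ℂ) ^ (-(s : ℂ)) - ((n + 2 : ℕ) : ℂ) ^ (-(s : ℂ))) =
      (((∑ i ∈ Finset.range (n + 1), (χ ((i + 1 : ℕ) : ZMod d)).re) *
      (((n + 1 : ℕ) : ℝ) ^ (-s) - ((n + 2 : ℕ) : ℝ) ^ (-s)) : ℝ) : ℂ) := by
    intro n
    rw [Complex.ofReal_mul, Complex.ofReal_sum, Complex.ofReal_sub,
      Complex.ofReal_cpow (by positivity), Complex.ofReal_cpow (by positivity)]
    simp only [DirichletCharacter.ofReal_re_apply_of_sq_eq_one hχ, Complex.ofReal_natCast,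
      Complex.ofReal_neg]
  simp_rw [e] at h
  refine ⟨by simpa using Complex.hasSum_re h, ?_⟩
  have := Complex.hasSum_im h
  simp only [Complex.ofReal_im] at this
  exact this.unique hasSum_zero

theorem LFunction_two_re_pos : 0 < (χ.LFunction 2).re := by
  have h1 : (1 : ℝ) < (2 : ℂ).re := by norm_num
  rw [DirichletCharacter.LFunction_eq_LSeries χ h1]
  have hs := (DirichletCharacter.LSeriesSummable_of_one_lt_re χ h1)
  have hz : HasSum (fun n : ℕ ↦ 1 / ((n : ℝ) + 1) ^ 2) (Real.pi ^ 2 / 6) := by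
    have := (hasSum_nat_add_iff' 1).2 hasSum_zeta_two
    simpa using this
  have hz1 : HasSum (fun n : ℕ ↦ 1 / ((n : ℝ) + 1 + 1) ^ 2) (Real.pi ^ 2 / 6 - 1) := by
    have := (hasSum_nat_add_iff' 1).2 hz
    simpa using this
  have hL : LSeries (fun n ↦ χ n) 2 = 1 + ∑' n : ℕ, LSeries.term (fun n ↦ χ n) 2 (n + 2) := by
    rw [LSeries, ← hs.sum_add_tsum_nat_add 2]
    simp [Finset.sum_range_succ, LSeries.term]
  have hb : ‖∑' n : ℕ, LSeries.term (fun n ↦ χ n) 2 (n + 2)‖ ≤ Real.pi ^ 2 / 6 - 1 := by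
    refine tsum_of_norm_bounded hz1 fun n ↦ ?_
    rw [LSeries.norm_term_eq, if_neg (by omega)]
    have hx := DirichletCharacter.norm_le_one χ ((n + 2 : ℕ) : ZMod d)
    have e : ((n : ℝ) + 1 + 1) ^ 2 = ((n + 2 : ℕ) : ℝ) ^ (2 : ℂ).re := by
      rw [show (2 : ℂ).re = ((2 : ℕ) : ℝ) by norm_num, Real.rpow_natCast]
      push_cast
      ring
    rw [e]
    gcongr
  have hre := (abs_le.1 ((Complex.abs_re_le_norm _).trans hb)).1
  rw [hL, Complex.add_re, Complex.one_re]
  have := Real.pi_lt_d2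
  nlinarith [Real.pi_pos]

theorem LFunction_re_pos_of_ne_zero (hχ : χ ^ 2 = 1) (hχ1 : χ ≠ 1) {β : ℝ} (h0 : 0 < β) (hβ : β < 1)
    (h : ∀ s : ℝ, β ≤ s → s < 1 → χ.LFunction s ≠ 0) {s : ℝ} (hs : β ≤ s) :
    0 < (χ.LFunction s).re := by
  have hne : ∀ s : ℝ, β ≤ s → (χ.LFunction s).re ≠ 0 := by
    intro s hs h0'
    have him := (hasSum_re_LFunction hχ hχ1 (h0.trans_le hs)).2
    have hz : χ.LFunction s = 0 := Complex.ext h0' him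
    rcases lt_or_ge s 1 with h1 | h1
    · exact h s hs h1 hz
    · exact DirichletCharacter.LFunction_ne_zero_of_one_le_re χ (Or.inl hχ1) (by simpa using h1) hz
  have hcont : Continuous fun s : ℝ ↦ (χ.LFunction s).re :=
    Complex.continuous_re.comp ((DirichletCharacter.differentiable_LFunction hχ1).continuous.comp
      Complex.continuous_ofReal)
  by_contra! hle
  obtain ⟨t, ht, ht0⟩ := intermediate_value_uIcc (a := s) (b := 2) hcont.continuousOn
    (Set.mem_uIcc.2 (Or.inl ⟨hle, by exact_mod_cast LFunction_two_re_pos.le⟩))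
  exact hne t ((le_inf hs (by linarith)).trans ht.1) ht0

theorem lt_re_LFunction_one (hχ : χ ^ 2 = 1) (hχ1 : χ ≠ 1) (hd : Real.exp 11.2 ≤ d)
    (h : ∀ s : ℝ, 1 - 1 / (4 * Real.log d) ≤ s → s < 1 → χ.LFunction s ≠ 0) :
    0.655 / (Real.exp 1 * Real.log d) < (χ.LFunction 1).re := by
  have hlog : 11.2 ≤ Real.log d := (Real.le_log_iff_exp_le ((Real.exp_pos _).trans_le hd)).2 hd
  have hδ0 : 0 < 1 / (4 * Real.log d) := by positivity
  have hδ1 : 1 / (4 * Real.log d) ≤ 1 / 44.8 :=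
    one_div_le_one_div_of_le (by norm_num) (by linarith)
  norm_num at hδ1
  have hβ0 : 0 < 1 - 1 / (4 * Real.log d) := by norm_num; linarith
  refine lt_of_partialSum (x := fun n ↦ (χ ((n + 1 : ℕ) : ZMod d)).re) hd (fun n ↦ ?_) (fun n ↦ ?_)
    (LFunction_re_pos_of_ne_zero hχ hχ1 hβ0 (by linarith) h le_rfl).le
    (hasSum_re_LFunction hχ hχ1 hβ0).1 ?_ fun t ht ↦ sum_exp_le_tsum hχ ht
  · rw [← Complex.re_sum]
    exact (Complex.abs_re_le_norm _).trans (norm_sum_range_dirichletCharacter_le hχ1 n)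
  · exact (Complex.abs_re_le_norm _).trans (χ.norm_le_one _)
  · simpa only [Complex.ofReal_one] using (hasSum_re_LFunction hχ hχ1 one_pos).1

end

end

section

open NumberTheorySymbols

variable {D : ℤ} {χ : DirichletCharacter ℂ D.natAbs}

namespace IsKroneckerChar

theorem apply_eq_zero (χ : DirichletCharacter ℂ D.natAbs) {n : ℕ} (h : ¬ n.Coprime D.natAbs) :
    χ (n : ZMod D.natAbs) = 0 :=
  χ.map_nonunit fun hu ↦ h ((ZMod.isUnit_iff_coprime n _).1 hu)

theorem apply_eq_jacobiSym (hχ : IsKroneckerChar D χ) {n : ℕ} (hn : Odd n) :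
    χ (n : ZMod D.natAbs) = (J(D | n) : ℂ) := by
  induction n using induction_on_primes with
  | zero => simp at hn
  | one => simp
  | prime_mul p a hp ih =>
    have hodd := Nat.odd_mul.1 hn
    have := Fact.mk hp
    rw [jacobiSym.mul_right' D hp.ne_zero hodd.2.pos.ne', Nat.cast_mul, map_mul, ih hodd.2,
      ← jacobiSym.legendreSym.to_jacobiSym p]
    push_cast
    congr 1
    by_cases hpD : (p : ℤ) ∣ D
    · rw [apply_eq_zero, (legendreSym.eq_zero_iff p D).2 ((ZMod.intCast_zmod_eq_zero_iff_dvd D p).2 hpD)]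
      · simp
      · rw [hp.coprime_iff_not_dvd, not_not]
        exact Int.natCast_dvd.1 hpD
    · exact hχ p hp (by rintro rfl; exact absurd hodd.1 (by decide)) hpD

theorem exists_odd_natCast_eq (hD : D ≠ 0) (a : (ZMod D.natAbs)ˣ) :
    ∃ n : ℕ, Odd n ∧ (n : ZMod D.natAbs) = a := by
  have : NeZero D.natAbs := ⟨by simpa using hD⟩
  rcases Nat.even_or_odd (a : ZMod D.natAbs).val with h | h
  · refine ⟨(a : ZMod D.natAbs).val + D.natAbs, ?_, by simp⟩
    have hc := ZMod.val_coe_unit_coprime a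
    refine h.add_odd ?_
    rw [← Nat.not_even_iff_odd]
    intro h2
    exact absurd (Nat.dvd_gcd h.two_dvd h2.two_dvd) (by rw [hc]; decide)
  · exact ⟨_, h, by simp⟩

theorem sq_eq_one (hχ : IsKroneckerChar D χ) (hD : D ≠ 0) : χ ^ 2 = 1 := by
  ext a
  obtain ⟨n, hn, ha⟩ := exists_odd_natCast_eq hD a
  have hu : IsUnit (n : ZMod D.natAbs) := ha ▸ a.isUnit
  rw [MulChar.pow_apply_coe, MulChar.one_apply_coe, ← ha, hχ.apply_eq_jacobiSym hn]
  have hc : D.gcd n = 1 := by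
    rw [Int.gcd_eq_natAbs, Int.natAbs_natCast]
    exact ((ZMod.isUnit_iff_coprime n _).1 hu).symm
  exact_mod_cast jacobiSym.sq_one hc

theorem apply_neg_one (hχ : IsKroneckerChar D χ) (hD : D < 0) : χ (-1) = -1 := by
  obtain ⟨m, hm⟩ : ∃ m, m = D.natAbs := ⟨_, rfl⟩
  have hmpos : 0 < m := by omega
  have hDm : D = -1 * (m : ℤ) := by omega
  have hn : Odd (4 * m - 1) := by rw [Nat.odd_iff]; omega
  have h1 : ((4 * m - 1 : ℕ) : ZMod D.natAbs) = -1 := by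
    rw [hm, Nat.cast_sub (by omega)]; simp
  have h2 := hχ.apply_eq_jacobiSym hn
  rw [h1] at h2
  have h4 : J((m : ℤ) | 4 * m - 1) = 1 := by
    have h5 : J(4 * (m : ℤ) | 4 * m - 1) = 1 := by
      rw [jacobiSym.mod_left' (a₂ := 1), jacobiSym.one_left]
      have : 4 * (m : ℤ) = 1 + ((4 * m - 1 : ℕ) : ℤ) := by omega
      rw [this, Int.add_emod_right]
    rwa [jacobiSym.mul_left, jacobiSym.at_four hn, one_mul] at h5
  have h3 : J(D | 4 * m - 1) = -1 := by
    rw [hDm, jacobiSym.mul_left, h4, mul_one, jacobiSym.at_neg_one hn,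
      ZMod.χ₄_nat_three_mod_four (by omega)]
  rw [h2, h3]
  simp

theorem ne_one (hχ : IsKroneckerChar D χ) (hD : D < 0) : χ ≠ 1 := by
  intro h
  have h1 := hχ.apply_neg_one hD
  rw [h, MulChar.one_apply isUnit_one.neg] at h1
  norm_num at h1

theorem apply_two (hχ : IsKroneckerChar D χ) (hD : D < 0) (h4 : D % 4 = 1) :
    χ 2 = if D % 8 = 1 then 1 else -1 := by
  obtain ⟨m, hm⟩ : ∃ m, m = D.natAbs := ⟨_, rfl⟩
  have hDm : D = -1 * (m : ℤ) := by omega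
  have hmodd : Odd m := by rw [Nat.odd_iff]; omega
  have hn : Odd (m + 2) := by rw [Nat.odd_iff]; omega
  have h1 : ((m + 2 : ℕ) : ZMod D.natAbs) = 2 := by simp [hm]
  have h2 := hχ.apply_eq_jacobiSym hn
  rw [h1] at h2
  rw [h2, hDm, jacobiSym.mul_left, jacobiSym.at_neg_one hn, ZMod.χ₄_nat_one_mod_four (by omega),
    ← jacobiSym.quadratic_reciprocity_one_mod_four (by omega) hmodd,
    jacobiSym.mod_left' (a₂ := 2) (by push_cast; simp), jacobiSym.at_two hmodd, ZMod.χ₈_nat_eq_if_mod_eight]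
  split_ifs <;> first | omega | simp

end IsKroneckerChar

end

section

open QuadraticAlgebra NumberField

theorem QuadraticAlgebra.algebraTrace_eq {R : Type*} [CommRing R] {a b : R}
    (z : QuadraticAlgebra R a b) : Algebra.trace R _ z = 2 * z.re + b * z.im := by
  rw [Algebra.trace_eq_matrix_trace (QuadraticAlgebra.basis a b), Matrix.trace_fin_two]
  simp only [Algebra.leftMulMatrix_eq_repr_mul]
  simp [QuadraticAlgebra.basis]
  ring

theorem QuadraticAlgebra.discr_basis {R : Type*} [CommRing R] (a b : R) :
    Algebra.discr R (QuadraticAlgebra.basis a b) = b ^ 2 + 4 * a := by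
  rw [Algebra.discr_def, Matrix.det_fin_two]
  simp only [Algebra.traceMatrix_apply, Algebra.traceForm_apply, algebraTrace_eq]
  simp [QuadraticAlgebra.basis]
  ring

theorem NumberField.exists_quadraticAlgebra_ringEquiv {K : Type*} [Field K] [NumberField K]
    (hK : Module.finrank ℚ K = 2) :
    ∃ a b : ℤ, Nonempty (QuadraticAlgebra ℤ a b ≃+* 𝓞 K) ∧ discr K = b ^ 2 + 4 * a := by
  have hrank : Module.finrank ℤ (𝓞 K) = 2 := (RingOfIntegers.rank K).trans hK
  let B : Module.Basis (Fin 2) ℤ (𝓞 K) := Module.finBasisOfFinrankEq ℤ (𝓞 K) hrank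
  have hB (z : 𝓞 K) : z = B.repr z 0 • B 0 + B.repr z 1 • B 1 := by
    simpa using (B.sum_repr z).symm
  obtain ⟨x, y, h1⟩ : ∃ x y : ℤ, (1 : 𝓞 K) = x • B 0 + y • B 1 := ⟨_, _, hB 1⟩
  have hind {m n : ℤ} (h : m • B 0 + n • B 1 = 0) : m = 0 ∧ n = 0 := by
    have := Fintype.linearIndependent_iff.1 B.linearIndependent ![m, n] (by simpa using h)
    exact ⟨this 0, this 1⟩
  have hxy : IsCoprime x y := by
    rw [Int.isCoprime_iff_gcd_eq_one]
    obtain ⟨x', hx'⟩ := Int.gcd_dvd_left x y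
    obtain ⟨y', hy'⟩ := Int.gcd_dvd_right x y
    set g := Int.gcd x y
    have hu : IsUnit (algebraMap ℤ (𝓞 K) g) := by
      refine IsUnit.of_mul_eq_one (x' • B 0 + y' • B 1) ?_
      rw [h1, hx', hy', ← Algebra.smul_def]
      module
    have := hu.map (Algebra.norm ℤ)
    rw [Algebra.norm_algebraMap_of_basis B, Fintype.card_fin, isUnit_pow_iff two_ne_zero,
      Int.isUnit_iff] at this
    omega
  obtain ⟨u, v, huv⟩ := hxy
  let w : 𝓞 K := (-v) • B 0 + u • B 1
  have hspan (z : 𝓞 K) : ∃ m n : ℤ, z = m • 1 + n • w := by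
    generalize hc : B.repr z 0 = c
    generalize hd : B.repr z 1 = d
    refine ⟨u * c + v * d, x * d - y * c, ?_⟩
    rw [hB z, hc, hd, h1]
    have h₁ : c = (u * c + v * d) * x - (x * d - y * c) * v := by linear_combination -c * huv
    have h₂ : d = (u * c + v * d) * y + (x * d - y * c) * u := by linear_combination -d * huv
    conv_lhs => rw [h₁, h₂]
    simp only [w]
    module
  have hinj {m n : ℤ} (h : m • (1 : 𝓞 K) + n • w = 0) : m = 0 ∧ n = 0 := by
    obtain ⟨h₁, h₂⟩ := hind (m := m * x - n * v) (n := m * y + n * u) (by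
      rw [← h, h1]; simp only [w]; module)
    constructor
    · linear_combination u * h₁ + v * h₂ - m * huv
    · linear_combination x * h₂ - y * h₁ - n * huv
  obtain ⟨a, b, hw⟩ := hspan (w * w)
  let f := QuadraticAlgebra.lift ⟨w, hw⟩
  have hf (z : QuadraticAlgebra ℤ a b) : f z = z.re • 1 + z.im • w := rfl
  let e : QuadraticAlgebra ℤ a b ≃ₐ[ℤ] 𝓞 K := AlgEquiv.ofBijective f
    ⟨(injective_iff_map_eq_zero f).2 fun z hz ↦ by
      obtain ⟨h₁, h₂⟩ := hinj ((hf z).symm.trans hz)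
      exact QuadraticAlgebra.ext h₁ h₂,
    fun z ↦ by
      obtain ⟨m, n, h⟩ := hspan z
      exact ⟨⟨m, n⟩, by rw [hf, h]⟩⟩
  refine ⟨a, b, ⟨e.toRingEquiv⟩, ?_⟩
  rw [← NumberField.discr_eq_discr K ((QuadraticAlgebra.basis a b).map e.toLinearEquiv),
    ← QuadraticAlgebra.discr_basis]
  exact (Algebra.discr_eq_discr_of_algEquiv _ e).symm

end

section

open Ideal NumberField

section Dedekind

variable {S : Type*} [CommRing S] [IsDedekindDomain S] [Module.Free ℤ S]

theorem Ideal.natCast_mem_of_absNorm_eq {I : Ideal S} {n : ℕ} (h : absNorm I = n) : (n : S) ∈ I :=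
  h ▸ absNorm_mem I

theorem Ideal.mul_sup_span_absNorm {I J : Ideal S} {m n : ℕ} (hmn : m.Coprime n)
    (hI : absNorm I = m) (hJ : absNorm J = n) : I * J ⊔ span {(m : S)} = I := by
  have hm : span {(m : S)} ≤ I := (span_singleton_le_iff_mem _).2 (natCast_mem_of_absNorm_eq hI)
  have htop : J ⊔ span {(m : S)} = ⊤ := by
    rw [← isCoprime_iff_sup_eq]
    have : IsCoprime (span {(n : S)}) (span {(m : S)}) := by
      rw [isCoprime_span_singleton_iff]
      simpa using (Nat.isCoprime_iff_coprime.2 hmn.symm).map (Int.castRingHom S)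
    rw [isCoprime_iff_sup_eq, eq_top_iff] at this ⊢
    exact this.trans (sup_le_sup_right
      ((span_singleton_le_iff_mem _).2 (natCast_mem_of_absNorm_eq hJ)) _)
  refine le_antisymm (sup_le mul_le_left hm) ?_
  calc I = I * (J ⊔ span {(m : S)}) := by rw [htop, mul_top]
    _ = I * J ⊔ I * span {(m : S)} := mul_sup _ _ _
    _ ≤ _ := sup_le_sup_left mul_le_right _

variable [Module.Finite ℤ S] [CharZero S]

theorem Ideal.finite_absNorm_eq (n : ℕ) : Finite {I : Ideal S // absNorm I = n} :=
  Ideal.finite_setOfPred_absNorm_eq n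

theorem Ideal.card_absNorm_mul_le {m n : ℕ} (hmn : m.Coprime n) :
    Nat.card {I : Ideal S // absNorm I = m} * Nat.card {I : Ideal S // absNorm I = n} ≤
      Nat.card {I : Ideal S // absNorm I = m * n} := by
  have := finite_absNorm_eq (S := S) (m * n)
  rw [← Nat.card_prod]
  refine Nat.card_le_card_of_injective
    (fun x ↦ ⟨x.1.1 * x.2.1, by rw [map_mul, x.1.2, x.2.2]⟩) ?_
  rintro ⟨⟨I, hI⟩, ⟨J, hJ⟩⟩ ⟨⟨I', hI'⟩, ⟨J', hJ'⟩⟩ h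
  simp only [Subtype.mk.injEq, Prod.mk.injEq] at h ⊢
  constructor
  · rw [← mul_sup_span_absNorm hmn hI hJ, h, mul_sup_span_absNorm hmn hI' hJ']
  · rw [← mul_sup_span_absNorm hmn.symm hJ hI, mul_comm, h, mul_comm,
      mul_sup_span_absNorm hmn.symm hJ' hI']

theorem Ideal.card_absNorm_pos {I : Ideal S} {n : ℕ} (hI : absNorm I = n) :
    1 ≤ Nat.card {I : Ideal S // absNorm I = n} := by
  have := finite_absNorm_eq (S := S) n
  have : Nonempty {I : Ideal S // absNorm I = n} := ⟨I, hI⟩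
  exact Nat.card_pos

theorem Ideal.succ_le_card_absNorm_prime_pow {p : ℕ} (hp : p.Prime) {P Q : Ideal S}
    (hP : absNorm P = p) (hQ : absNorm Q = p) (hPQ : P ≠ Q) (k : ℕ) :
    k + 1 ≤ Nat.card {I : Ideal S // absNorm I = p ^ k} := by
  have := finite_absNorm_eq (S := S) (p ^ k)
  have hP0 : P ≠ 0 := by
    rintro rfl
    exact hp.ne_zero (by simpa using hP.symm)
  have hPprime : Prime P := Ideal.prime_of_isPrime hP0
    (isPrime_of_irreducible_absNorm (hP ▸ hp))
  have hndvd (m : ℕ) : ¬ P ∣ Q ^ m := fun h ↦ by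
    obtain ⟨R, hR⟩ := hPprime.dvd_of_dvd_pow h
    have h1 : absNorm R = 1 := by
      have := congrArg absNorm hR
      rw [map_mul, hP, hQ] at this
      exact Nat.eq_of_mul_eq_mul_left hp.pos (by lia)
    rw [absNorm_eq_one_iff] at h1
    rw [hR, h1, mul_top] at hPQ
    exact hPQ rfl
  have hlt {i j : ℕ} (hij : i < j) (hj : j ≤ k) : P ^ i * Q ^ (k - i) ≠ P ^ j * Q ^ (k - j) := by
    intro h
    rw [← Nat.add_sub_cancel' hij.le, pow_add, mul_assoc] at h
    have h := mul_left_cancel₀ (pow_ne_zero i hP0) h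
    refine hndvd (k - i) (h ▸ (dvd_pow_self P ?_).mul_right _)
    lia
  rw [← Nat.card_fin (k + 1)]
  refine Nat.card_le_card_of_injective
    (fun i : Fin (k + 1) ↦ ⟨P ^ (i : ℕ) * Q ^ (k - i), ?_⟩) ?_
  · rw [map_mul, map_pow, map_pow, hP, hQ, ← pow_add]
    congr 1
    lia
  · intro i j h
    simp only [Subtype.mk.injEq] at h
    rcases lt_trichotomy (i : ℕ) j with hij | hij | hij
    · exact absurd h (hlt hij (by lia))
    · exact Fin.ext hij
    · exact absurd h.symm (hlt hij (by lia))

end Dedekind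

section Root

variable {S : Type*} [CommRing S] {a b : ℤ}

/-- The reduction map of a quadratic order attached to a root modulo `p` of the defining
polynomial `X ^ 2 - b X - a`. -/
def QuadraticAlgebra.evalRoot {p : ℕ} (t : ZMod p) (ht : t * t = a + b * t) :
    QuadraticAlgebra ℤ a b →+* ZMod p :=
  (QuadraticAlgebra.lift ⟨t, by simpa using ht⟩ : QuadraticAlgebra ℤ a b →ₐ[ℤ] ZMod p)

theorem QuadraticAlgebra.evalRoot_apply {p : ℕ} (t : ZMod p) (ht : t * t = a + b * t)
    (z : QuadraticAlgebra ℤ a b) : evalRoot t ht z = z.re + z.im * t := by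
  simp [evalRoot, QuadraticAlgebra.lift]

theorem QuadraticAlgebra.ker_evalRoot_ne {p : ℕ} [NeZero p] (e : QuadraticAlgebra ℤ a b ≃+* S)
    {t u : ZMod p} (ht : t * t = a + b * t) (hu : u * u = a + b * u) (htu : t ≠ u) :
    RingHom.ker ((evalRoot t ht).comp (e.symm : S →+* QuadraticAlgebra ℤ a b)) ≠
      RingHom.ker ((evalRoot u hu).comp (e.symm : S →+* QuadraticAlgebra ℤ a b)) := by
  intro h
  have h1 : e ⟨-(t.val : ℤ), 1⟩ ∈
      RingHom.ker ((evalRoot t ht).comp (e.symm : S →+* QuadraticAlgebra ℤ a b)) := by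
    simp [RingHom.mem_ker, evalRoot_apply]
  rw [h] at h1
  simp only [RingHom.mem_ker, RingHom.comp_apply, RingHom.coe_coe, RingEquiv.symm_apply_apply,
    evalRoot_apply] at h1
  refine htu (sub_eq_zero.1 ?_).symm
  simpa [sub_eq_neg_add] using h1

theorem QuadraticAlgebra.absNorm_ker_evalRoot [IsDedekindDomain S] [Module.Free ℤ S]
    {p : ℕ} [NeZero p] (e : QuadraticAlgebra ℤ a b ≃+* S)
    (t : ZMod p) (ht : t * t = a + b * t) :
    absNorm (RingHom.ker ((evalRoot t ht).comp (e.symm : S →+* QuadraticAlgebra ℤ a b))) = p := by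
  set f := (evalRoot t ht).comp (e.symm : S →+* QuadraticAlgebra ℤ a b)
  have hf : Function.Surjective f := ZMod.ringHom_surjective f
  rw [absNorm_apply, Submodule.cardQuot_apply]
  exact (Nat.card_congr (RingHom.quotientKerEquivOfSurjective hf).toEquiv).trans (Nat.card_zmod p)

end Root

end

section

open Ideal NumberField

variable {D : ℤ} {χ : DirichletCharacter ℂ D.natAbs} {a b : ℤ}

namespace IsKroneckerChar

theorem apply_prime (hχ : IsKroneckerChar D χ) {p : ℕ} [hp : Fact p.Prime] (hp2 : p ≠ 2) :
    χ (p : ZMod D.natAbs) = (legendreSym p D : ℂ) := by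
  rw [hχ.apply_eq_jacobiSym (hp.out.odd_of_ne_two hp2), jacobiSym.legendreSym.to_jacobiSym]

theorem exists_root_two {a b : ℤ} (hb : Even b) :
    ∃ t : ZMod 2, t * t = a + b * t := by
  have hb' : (b : ZMod 2) = 0 := (ZMod.intCast_zmod_eq_zero_iff_dvd b 2).2 hb.two_dvd
  rw [hb']
  generalize (a : ZMod 2) = x
  revert x
  decide

theorem apply_two_ne_zero (hχ : IsKroneckerChar D χ) (hD0 : D < 0) (hD : D = b ^ 2 + 4 * a)
    (hb : Odd b) : (D % 8 = 1 ∧ χ 2 = 1) ∨ χ 2 = -1 := by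
  obtain ⟨c, rfl⟩ := hb
  have h4 : D % 4 = 1 := by
    rw [hD, show (2 * c + 1) ^ 2 + 4 * a = 4 * (c ^ 2 + c + a) + 1 by ring]
    omega
  rw [hχ.apply_two hD0 h4]
  split_ifs with h
  · exact .inl ⟨h, rfl⟩
  · exact .inr rfl

theorem exists_root_of_apply_eq_zero (hχ : IsKroneckerChar D χ) (hD0 : D < 0)
    (hD : D = b ^ 2 + 4 * a) {p : ℕ} [hp : Fact p.Prime] (h : χ (p : ZMod D.natAbs) = 0) :
    ∃ t : ZMod p, t * t = a + b * t := by
  rcases eq_or_ne p 2 with rfl | hp2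
  · rcases Int.even_or_odd b with hb | hb
    · exact exists_root_two hb
    · rcases apply_two_ne_zero hχ hD0 hD hb with h' | h' <;> simp_all
  · have h2 : (2 : ZMod p) ≠ 0 := by
      exact ZMod.prime_ne_zero p 2 hp2
    rw [hχ.apply_prime hp2, Int.cast_eq_zero, legendreSym.eq_zero_iff, hD] at h
    push_cast at h
    refine ⟨b / 2, ?_⟩
    field_simp
    linear_combination -h

theorem exists_roots_of_apply_eq_one (hχ : IsKroneckerChar D χ) (hD0 : D < 0)
    (hD : D = b ^ 2 + 4 * a) {p : ℕ} [hp : Fact p.Prime] (h : χ (p : ZMod D.natAbs) = 1) :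
    ∃ t u : ZMod p, t ≠ u ∧ t * t = a + b * t ∧ u * u = a + b * u := by
  rcases eq_or_ne p 2 with rfl | hp2
  · rcases Int.even_or_odd b with hb | hb
    · rw [apply_eq_zero] at h
      · simp at h
      · rw [Nat.prime_two.coprime_iff_not_dvd, not_not, ← Int.natCast_dvd, hD]
        exact dvd_add (dvd_pow hb.two_dvd two_ne_zero) ⟨2 * a, by push_cast; ring⟩
    · rcases apply_two_ne_zero hχ hD0 hD hb with ⟨h8, -⟩ | h'
      · obtain ⟨c, rfl⟩ := hb
        obtain ⟨d, hd⟩ := Int.even_mul_succ_self c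
        have ha : (2 : ℤ) ∣ a := by
          rw [hD, show (2 * c + 1) ^ 2 + 4 * a = 4 * (c * (c + 1) + a) + 1 by ring] at h8
          omega
        have ha' : (a : ZMod 2) = 0 := (ZMod.intCast_zmod_eq_zero_iff_dvd a 2).2 ha
        have h2 : (2 : ZMod 2) = 0 := CharTwo.two_eq_zero
        refine ⟨0, 1, zero_ne_one, by simp [ha'], by simp [ha', h2]⟩
      · norm_num [h'] at h
  · have h2 : (2 : ZMod p) ≠ 0 := ZMod.prime_ne_zero p 2 hp2
    rw [hχ.apply_prime hp2, Int.cast_eq_one] at h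
    have hD' : (D : ZMod p) ≠ 0 := fun h0 ↦ by
      rw [(legendreSym.eq_zero_iff p D).2 h0] at h
      exact zero_ne_one h
    obtain ⟨s, hs⟩ := (legendreSym.eq_one_iff p hD').1 h
    have hs0 : s ≠ 0 := by
      rintro rfl
      exact hD' (by simpa using hs)
    rw [hD] at hs
    push_cast at hs
    refine ⟨(b + s) / 2, (b - s) / 2, fun h ↦ ?_, ?_, ?_⟩
    · field_simp at h
      have : 2 * s = 0 := by linear_combination h
      simp_all
    · field_simp
      linear_combination -hs
    · field_simp
      linear_combination -hs

variable {S : Type*} [CommRing S] [IsDedekindDomain S] [Module.Free ℤ S] [Module.Finite ℤ S]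
  [CharZero S]

theorem exists_zetaMul_prime_pow_eq (hχ : IsKroneckerChar D χ) (hD0 : D < 0)
    (hD : D = b ^ 2 + 4 * a) (e : QuadraticAlgebra ℤ a b ≃+* S) {p : ℕ} (hp : p.Prime) (k : ℕ) :
    ∃ m : ℕ, χ.zetaMul (p ^ k) = m ∧ m ≤ Nat.card {I : Ideal S // absNorm I = p ^ k} := by
  have := Fact.mk hp
  simp only [χ.zetaMul_apply, Nat.sum_divisors_prime_pow hp, Nat.cast_pow, map_pow]
  rcases MulChar.isQuadratic_iff_sq_eq_one.mpr (hχ.sq_eq_one hD0.ne) p with h | h | h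
  · obtain ⟨t, ht⟩ := hχ.exists_root_of_apply_eq_zero hD0 hD h
    refine ⟨1, by simp [h, Finset.sum_range_succ'], card_absNorm_pos
      (I := RingHom.ker ((QuadraticAlgebra.evalRoot t ht).comp (e.symm : S →+* _)) ^ k) ?_⟩
    rw [map_pow, QuadraticAlgebra.absNorm_ker_evalRoot e t ht]
  · obtain ⟨t, u, htu, ht, hu⟩ := hχ.exists_roots_of_apply_eq_one hD0 hD h
    exact ⟨k + 1, by simp [h], succ_le_card_absNorm_prime_pow hp
      (QuadraticAlgebra.absNorm_ker_evalRoot e t ht)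
      (QuadraticAlgebra.absNorm_ker_evalRoot e u hu)
      (QuadraticAlgebra.ker_evalRoot_ne e ht hu htu) k⟩
  · simp only [h, neg_one_geom_sum]
    rcases Nat.even_or_odd k with hk | hk
    · rw [if_neg (by simpa [Nat.even_add_one] using hk)]
      obtain ⟨l, rfl⟩ := hk
      refine ⟨1, by simp, card_absNorm_pos (I := span {((p ^ l : ℕ) : S)}) ?_⟩
      have hrank : Module.finrank ℤ S = 2 := by
        rw [← (e.toIntAlgEquiv.toLinearEquiv).finrank_eq, QuadraticAlgebra.finrank_eq_two]
      rw [absNorm_span_natCast, hrank, ← pow_mul, mul_two]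
    · exact ⟨0, by simp [hk], Nat.zero_le _⟩

theorem exists_zetaMul_eq (hχ : IsKroneckerChar D χ) (hD0 : D < 0)
    (hD : D = b ^ 2 + 4 * a) (e : QuadraticAlgebra ℤ a b ≃+* S) (n : ℕ) :
    ∃ m : ℕ, χ.zetaMul n = m ∧ m ≤ Nat.card {I : Ideal S // absNorm I = n} := by
  have hm := χ.isMultiplicative_zetaMul
  induction n using Nat.recOnPosPrimePosCoprime with
  | prime_pow p k hp _ => exact hχ.exists_zetaMul_prime_pow_eq hD0 hD e hp k
  | zero => exact ⟨0, by simp, Nat.zero_le _⟩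
  | one => exact ⟨1, by simp [hm.map_one], card_absNorm_pos absNorm_top⟩
  | coprime x y _ _ hxy hx hy =>
    obtain ⟨m, hm₁, hm₂⟩ := hx
    obtain ⟨n, hn₁, hn₂⟩ := hy
    exact ⟨m * n, by rw [hm.map_mul_of_coprime hxy, hm₁, hn₁]; norm_cast,
      (Nat.mul_le_mul hm₂ hn₂).trans (card_absNorm_mul_le hxy)⟩

end IsKroneckerChar

end

section

open Filter Topology NumberField Ideal

theorem LSeries_re_le_LSeries_re {f g : ℕ → ℝ} (hfg : ∀ n, f n ≤ g n) {s : ℝ}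
    (hf : LSeriesSummable (fun n ↦ f n) s) (hg : LSeriesSummable (fun n ↦ g n) s) :
    (LSeries (fun n ↦ f n) s).re ≤ (LSeries (fun n ↦ g n) s).re := by
  refine hasSum_le (fun n ↦ ?_) (Complex.hasSum_re hf.hasSum) (Complex.hasSum_re hg.hasSum)
  rw [LSeries.term_def, LSeries.term_def]
  split_ifs
  · rfl
  · rw [← Complex.ofReal_natCast n, ← Complex.ofReal_cpow n.cast_nonneg, ← Complex.ofReal_div,
      ← Complex.ofReal_div, Complex.ofReal_re, Complex.ofReal_re]
    exact div_le_div_of_nonneg_right (hfg n) (by positivity)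

theorem NumberField.tendsto_sum_card_absNorm_div (K : Type*) [Field K] [NumberField K] :
    Tendsto (fun n : ℕ ↦
      (∑ k ∈ Finset.Icc 1 n, (Nat.card {I : Ideal (𝓞 K) // absNorm I = k} : ℝ)) / n)
      atTop (𝓝 (dedekindZeta_residue K)) := by
  refine ((Ideal.tendsto_norm_le_div_atTop₀ K).comp tendsto_natCast_atTop_atTop).congr fun n ↦ ?_
  simp only [Function.comp_apply, Nat.cast_le, ← Nat.cast_sum]
  congr
  rw [← add_left_inj 1, ← card_norm_le_eq_card_norm_le_add_one,
    show Finset.Icc 1 n = Finset.Ioc 0 n from Finset.Icc_succ_left_eq_Ioc _ _,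
    show 1 = Nat.card {I : Ideal (𝓞 K) // absNorm I = 0} by simp [Ideal.absNorm_eq_zero_iff],
    Finset.sum_Ioc_add_eq_sum_Icc (n.zero_le),
    ← Finset.card_preimage_eq_sum_card_image_eq (fun k _ ↦ finite_setOfPred_absNorm_eq k)]
  simp [Set.coe_eq_subtype]

theorem NumberField.LSeriesSummable_card_absNorm (K : Type*) [Field K] [NumberField K] {s : ℝ}
    (hs : 1 < s) :
    LSeriesSummable (fun n ↦ ((Nat.card {I : Ideal (𝓞 K) // absNorm I = n} : ℝ) : ℂ)) s :=
  LSeriesSummable_of_sum_norm_bigO_and_nonneg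
    (Asymptotics.isBigO_atTop_natCast_rpow_of_tendsto_div_rpow (by simpa using tendsto_sum_card_absNorm_div K))
    (fun _ ↦ Nat.cast_nonneg _) zero_le_one hs

theorem DirichletCharacter.LSeries_zetaMul {d : ℕ} [NeZero d] (χ : DirichletCharacter ℂ d) {s : ℂ}
    (hs : 1 < s.re) : LSeries χ.zetaMul s = riemannZeta s * χ.LFunction s := by
  rw [zetaMul, ← ArithmeticFunction.coe_mul, LSeries_convolution', χ.LFunction_eq_LSeries hs]
  · congr 1
    · simp_rw [← ArithmeticFunction.LSeries_zeta_eq_riemannZeta hs, ← ArithmeticFunction.natCoe_apply]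
    · exact (LSeries_congr χ.apply_eq_toArithmeticFunction_apply s).symm
  · exact ArithmeticFunction.LSeriesSummable_zeta_iff.mpr hs
  · exact (LSeriesSummable_congr _ fun h ↦ (χ.apply_eq_toArithmeticFunction_apply h).symm).mpr <|
      ZMod.LSeriesSummable_of_one_lt_re χ hs

theorem DirichletCharacter.tendsto_sub_one_mul_LSeries_zetaMul {d : ℕ} [NeZero d]
    {χ : DirichletCharacter ℂ d} (hχ : χ ≠ 1) :
    Tendsto (fun s : ℝ ↦ ((s - 1 : ℂ) * LSeries χ.zetaMul s)) (𝓝[>] 1) (𝓝 (χ.LFunction 1)) := by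
  have h1 : Tendsto (fun s : ℝ ↦ (s : ℂ)) (𝓝[>] 1) (𝓝[≠] 1) := by
    refine tendsto_nhdsWithin_iff.2 ⟨?_, ?_⟩
    · exact (Complex.continuous_ofReal.tendsto' 1 1 (by simp)).mono_left nhdsWithin_le_nhds
    · filter_upwards [self_mem_nhdsWithin] with s hs
      simpa using (ne_of_gt hs)
  have h2 := riemannZeta_residue_one.comp h1
  have h3 := ((χ.differentiable_LFunction hχ).continuous.tendsto 1).comp
    (h1.mono_right nhdsWithin_le_nhds)
  refine ((h2.mul h3).congr' ?_).trans (by simp)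
  filter_upwards [self_mem_nhdsWithin] with s hs
  rw [χ.LSeries_zetaMul (by simpa using hs)]
  simp [mul_assoc]

theorem IsKroneckerChar.re_LFunction_one_le {K : Type*} [Field K] [NumberField K]
    (hK : Module.finrank ℚ K = 2) (hD : discr K < 0) [NeZero (discr K).natAbs]
    {χ : DirichletCharacter ℂ (discr K).natAbs} (hχ : IsKroneckerChar (discr K) χ) :
    (χ.LFunction 1).re ≤ dedekindZeta_residue K := by
  obtain ⟨a, b, ⟨e⟩, hab⟩ := exists_quadraticAlgebra_ringEquiv hK
  choose m hm hmle using hχ.exists_zetaMul_eq hD hab e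
  have h1 := (Complex.continuous_re.tendsto _).comp
    (DirichletCharacter.tendsto_sub_one_mul_LSeries_zetaMul (hχ.ne_one hD))
  have h2 := (Complex.continuous_re.tendsto _).comp (tendsto_sub_one_mul_dedekindZeta_nhdsGT K)
  refine le_of_tendsto_of_tendsto h1 (by simpa using h2) ?_
  filter_upwards [self_mem_nhdsWithin] with s hs
  simp only [Function.comp_apply, ← Complex.ofReal_one, ← Complex.ofReal_sub,
    Complex.re_ofReal_mul]
  refine mul_le_mul_of_nonneg_left ?_ (sub_nonneg.2 (le_of_lt hs))
  have hz : (χ.zetaMul : ℕ → ℂ) = fun n ↦ ((m n : ℝ) : ℂ) := funext fun n ↦ by simp [hm]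
  have hsum := χ.LSeriesSummable_zetaMul (s := (s : ℂ)) (by simpa using hs)
  rw [hz] at hsum ⊢
  exact LSeries_re_le_LSeries_re (fun n ↦ Nat.cast_le.2 (hmle n)) hsum
    (LSeriesSummable_card_absNorm K hs)

end

section

open NumberField NumberField.InfinitePlace

variable {K : Type*} [Field K] [NumberField K]

theorem NumberField.nrPlaces_of_finrank_eq_two (hK : Module.finrank ℚ K = 2) (hD : discr K < 0) :
    nrRealPlaces K = 0 ∧ nrComplexPlaces K = 1 := by
  have h1 := card_add_two_mul_card_eq_rank K
  have h2 := sign_discr K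
  rw [hK] at h1
  rw [Int.sign_eq_neg_one_of_neg hD] at h2
  have h3 : nrComplexPlaces K ≠ 0 := by
    intro h
    rw [h] at h2
    norm_num at h2
  lia

theorem NumberField.Units.regulator_eq_one_of_rank_eq_zero (h : Units.rank K = 0) :
    Units.regulator K = 1 := by
  classical
  have : IsEmpty {w : InfinitePlace K // w ≠ Units.dirichletUnitTheorem.w₀} := by
    have hcard : Fintype.card (InfinitePlace K) ≤ 1 := by
      rw [Units.rank] at h
      lia
    exact ⟨fun w ↦ w.2 (Fintype.card_le_one_iff.1 hcard _ _)⟩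
  rw [Units.regulator_eq_det', Matrix.det_isEmpty, abs_one]

theorem NumberField.dedekindZeta_residue_le (hK : Module.finrank ℚ K = 2) (hD : discr K < 0) :
    dedekindZeta_residue K ≤ Real.pi * classNumber K / √|discr K| := by
  obtain ⟨h1, h2⟩ := nrPlaces_of_finrank_eq_two hK hD
  have hrank : Units.rank K = 0 := by
    rw [Units.rank, card_eq_nrRealPlaces_add_nrComplexPlaces, h1, h2]
  have htors : (2 : ℝ) ≤ Units.torsionOrder K := by
    have h := Units.torsionOrder_pos K
    have h' := Units.even_torsionOrder K
    exact_mod_cast Nat.le_of_dvd h h'.two_dvd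
  have hsqrt : 0 < √(|discr K| : ℝ) := Real.sqrt_pos.2 (by simpa using hD.ne)
  rw [dedekindZeta_residue_def, h1, h2, Units.regulator_eq_one_of_rank_eq_zero hrank]
  rw [div_le_div_iff₀ (by positivity) hsqrt]
  have : 0 ≤ Real.pi * classNumber K * √(|discr K| : ℝ) := by positivity
  nlinarith

theorem IsKroneckerChar.lt_classNumber (hK : Module.finrank ℚ K = 2) (hD : discr K < 0)
    [NeZero (discr K).natAbs] {χ : DirichletCharacter ℂ (discr K).natAbs}
    (hχ : IsKroneckerChar (discr K) χ) (hd : Real.exp 11.2 ≤ (discr K).natAbs)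
    (h : ∀ s : ℝ, 1 - 1 / (4 * Real.log (discr K).natAbs) ≤ s → s < 1 → χ.LFunction s ≠ 0) :
    0.655 / (Real.pi * Real.exp 1) * (√(discr K).natAbs / Real.log (discr K).natAbs) <
      classNumber K := by
  have h1 := (lt_re_LFunction_one (hχ.sq_eq_one hD.ne) (hχ.ne_one hD) hd h).trans_le
    ((hχ.re_LFunction_one_le hK hD).trans (dedekindZeta_residue_le hK hD))
  have hsqrt : 0 < √((discr K).natAbs : ℝ) := Real.sqrt_pos.2 (by simpa using hD.ne)
  rw [show |(discr K : ℝ)| = ((discr K).natAbs : ℝ) by simp [Nat.cast_natAbs],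
    lt_div_iff₀ hsqrt] at h1
  rw [← mul_lt_mul_iff_right₀ Real.pi_pos]
  refine lt_of_eq_of_lt ?_ h1
  have := Real.pi_pos.ne'
  field_simp

end

section

open QuadraticAlgebra Ideal
open scoped nonZeroDivisors

theorem QuadraticAlgebra.four_mul_norm {R : Type*} [CommRing R] {a b : R}
    (z : QuadraticAlgebra R a b) :
    4 * z.norm = (2 * z.re + b * z.im) ^ 2 - (b ^ 2 + 4 * a) * z.im ^ 2 := by
  rw [norm_def]; ring

theorem QuadraticAlgebra.norm_nonneg_of_neg {a b : ℤ} (hD : b ^ 2 + 4 * a < 0)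
    (z : QuadraticAlgebra ℤ a b) : 0 ≤ z.norm := by
  nlinarith [four_mul_norm z, sq_nonneg (2 * z.re + b * z.im), sq_nonneg z.im]

theorem QuadraticAlgebra.algebraNorm_eq {R : Type*} [CommRing R] {a b : R}
    (z : QuadraticAlgebra R a b) : Algebra.norm R z = z.norm := by
  rw [Algebra.norm_eq_matrix_det (QuadraticAlgebra.basis a b), Matrix.det_fin_two]
  simp only [Algebra.leftMulMatrix_eq_repr_mul]
  simp [QuadraticAlgebra.basis, norm_def]
  ring

variable {S : Type*} [CommRing S] {a b : ℤ}

theorem QuadraticAlgebra.algebraNorm_ringEquiv (e : QuadraticAlgebra ℤ a b ≃+* S)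
    (z : QuadraticAlgebra ℤ a b) : Algebra.norm ℤ (e z) = z.norm := by
  rw [← algebraNorm_eq]
  exact Algebra.norm_eq_of_algEquiv e.toIntAlgEquiv z

theorem QuadraticAlgebra.ringEquiv_mul_star (e : QuadraticAlgebra ℤ a b ≃+* S)
    (z : QuadraticAlgebra ℤ a b) : e z * e (star z) = (z.norm : S) := by
  rw [← map_mul, ← algebraMap_norm_eq_mul_star]
  simp

theorem QuadraticAlgebra.ringEquiv_add_star (e : QuadraticAlgebra ℤ a b ≃+* S)
    (z : QuadraticAlgebra ℤ a b) : e z + e (star z) = (z.trace : S) := by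
  rw [← map_add, ← algebraMap_trace_eq_add_star]
  simp

theorem Ideal.span_singleton_intCast_natAbs (m : ℤ) :
    span {((m.natAbs : ℕ) : S)} = span {(m : S)} := by
  rcases Int.natAbs_eq m with h | h
  · conv_rhs => rw [h]
    simp
  · conv_rhs => rw [h]
    simp [span_singleton_neg]

variable [IsDedekindDomain S]

/-- The class `c` contains an ideal whose square is generated by the natural number `q`. -/
def ClassGroup.HasSqrtNat (c : ClassGroup S) (q : ℕ) : Prop :=
  ∃ J : (Ideal S)⁰, ClassGroup.mk0 J = c ∧ (J : Ideal S) ^ 2 = span {(q : S)}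

theorem ClassGroup.HasSqrtNat.unique {c c' : ClassGroup S} {q : ℕ} (h : c.HasSqrtNat q)
    (h' : c'.HasSqrtNat q) : c = c' := by
  obtain ⟨J, rfl, hJ⟩ := h
  obtain ⟨J', rfl, hJ'⟩ := h'
  have : (J : Ideal S) = J' := by
    apply dvd_antisymm <;> rw [← UniqueFactorizationMonoid.pow_dvd_pow_iff_dvd two_ne_zero, hJ, hJ']
  rw [Subtype.ext this]

theorem ClassGroup.HasSqrtNat.of_mul_sq [CharZero S] {c : ClassGroup S} {s k : ℕ} (hk : k ≠ 0)
    (h : c.HasSqrtNat (s * k ^ 2)) : c.HasSqrtNat s := by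
  obtain ⟨J, rfl, hJ⟩ := h
  have hk' : (k : S) ≠ 0 := mod_cast hk
  have hspan : span {((s * k ^ 2 : ℕ) : S)} = span {(k : S)} ^ 2 * span {(s : S)} := by
    rw [span_singleton_pow, span_singleton_mul_span_singleton]
    congr 2
    push_cast
    ring
  obtain ⟨I, hI⟩ : span {(k : S)} ∣ (J : Ideal S) := by
    rw [← UniqueFactorizationMonoid.pow_dvd_pow_iff_dvd two_ne_zero, hJ, hspan]
    exact dvd_mul_right _ _
  have hJ0 : (J : Ideal S) ≠ 0 := nonZeroDivisors.ne_zero J.2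
  have hI0 : I ≠ 0 := by rintro rfl; exact hJ0 (by rw [hI, mul_zero])
  refine ⟨⟨I, mem_nonZeroDivisors_of_ne_zero hI0⟩, ?_, ?_⟩
  · rw [ClassGroup.mk0_eq_mk0_iff]
    exact ⟨k, 1, hk', one_ne_zero, by simp [← hI]⟩
  · rw [hI, hspan, mul_pow] at hJ
    exact mul_left_cancel₀ (pow_ne_zero 2 (by simpa using hk')) hJ

theorem ClassGroup.HasSqrtNat.mul_natAbs {c : ClassGroup S} {q : ℕ} {D : ℤ} {δ : S}
    (hδ : δ ≠ 0) (hD : δ ^ 2 = D) (h : c.HasSqrtNat q) : c.HasSqrtNat (q * D.natAbs) := by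
  obtain ⟨J, rfl, hJ⟩ := h
  have hJ0 : (J : Ideal S) ≠ 0 := nonZeroDivisors.ne_zero J.2
  refine ⟨⟨span {δ} * J, mem_nonZeroDivisors_of_ne_zero (mul_ne_zero (by simpa) hJ0)⟩, ?_, ?_⟩
  · rw [ClassGroup.mk0_eq_mk0_iff]
    exact ⟨1, δ, one_ne_zero, hδ, by simp⟩
  · rw [mul_pow, hJ, span_singleton_pow, hD, ← span_singleton_intCast_natAbs,
      span_singleton_mul_span_singleton]
    congr 2
    push_cast
    ring

variable [Module.Free ℤ S] [Module.Finite ℤ S] [CharZero S]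

theorem ClassGroup.exists_hasSqrtNat (e : QuadraticAlgebra ℤ a b ≃+* S) (hD : b ^ 2 + 4 * a < 0)
    {c : ClassGroup S} (hc : c ^ 2 = 1) : ∃ q ≠ 0, c.HasSqrtNat q := by
  obtain ⟨I, rfl⟩ := ClassGroup.mk0_surjective c
  have hI0 : (I : Ideal S) ≠ 0 := nonZeroDivisors.ne_zero I.2
  have hp : ((I : Ideal S) ^ 2).IsPrincipal := by
    rw [← ClassGroup.mk0_eq_one_iff (pow_mem I.2 2), ← hc, ← map_pow]
    rfl
  obtain ⟨α, hα⟩ := hp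
  rw [submodule_span_eq] at hα
  obtain ⟨z, rfl⟩ := e.surjective α
  set n := absNorm (I : Ideal S) with hn
  have hn0 : n ≠ 0 := by rwa [hn, ne_eq, absNorm_eq_zero_iff]
  have hzn : z.norm = (n : ℤ) ^ 2 := by
    have := congrArg absNorm hα
    rw [map_pow, absNorm_span_singleton, algebraNorm_ringEquiv] at this
    have h := norm_nonneg_of_neg hD z
    zify at this
    rw [this, abs_of_nonneg h]
  have h₁ := ringEquiv_mul_star e z
  have h₂ := ringEquiv_add_star e z
  rw [hzn] at h₁
  push_cast at h₁
  by_cases h0 : e z = -n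
  · refine ⟨n, hn0, I, rfl, ?_⟩
    rw [hα, h0, span_singleton_neg]
  have hβ0 : e z + n ≠ 0 := fun h ↦ h0 (eq_neg_of_add_eq_zero_left h)
  set m : ℤ := z.trace + 2 * n with hm
  have hβ : (e z + n) ^ 2 = e z * m := by
    rw [hm]; push_cast; rw [← h₂]; linear_combination -h₁
  have hm0 : m ≠ 0 := by
    rintro h
    rw [h, Int.cast_zero, mul_zero] at hβ
    exact hβ0 (pow_eq_zero_iff two_ne_zero |>.1 hβ)
  have hspan : span {e z + n} ^ 2 = (I : Ideal S) ^ 2 * span {(m : S)} := by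
    rw [hα, span_singleton_pow, hβ, span_singleton_mul_span_singleton]
  obtain ⟨J, hJ⟩ : (I : Ideal S) ∣ span {e z + n} := by
    rw [← UniqueFactorizationMonoid.pow_dvd_pow_iff_dvd two_ne_zero, hspan]
    exact dvd_mul_right _ _
  have hJ0 : J ≠ 0 := by
    rintro rfl
    rw [mul_zero] at hJ
    exact hβ0 (span_singleton_eq_bot.1 hJ)
  refine ⟨m.natAbs, by simpa using hm0, ⟨J, mem_nonZeroDivisors_of_ne_zero hJ0⟩, ?_, ?_⟩
  · have : ClassGroup.mk0 I = (ClassGroup.mk0 I)⁻¹ := eq_inv_of_mul_eq_one_left (by rw [← sq, hc])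
    rw [this, ClassGroup.mk0_eq_mk0_inv_iff]
    exact ⟨e z + n, hβ0, by rw [hJ, mul_comm]⟩
  · rw [hJ, mul_pow] at hspan
    rw [span_singleton_intCast_natAbs]
    exact mul_left_cancel₀ (pow_ne_zero 2 hI0) hspan

end

section

open QuadraticAlgebra Ideal
open scoped nonZeroDivisors

variable {S : Type*} [CommRing S] {a b : ℤ}

theorem QuadraticAlgebra.natCast_dvd_ringEquiv_iff (e : QuadraticAlgebra ℤ a b ≃+* S) {n : ℕ}
    {z : QuadraticAlgebra ℤ a b} : (n : S) ∣ e z ↔ (n : ℤ) ∣ z.re ∧ (n : ℤ) ∣ z.im := by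
  rw [← map_natCast e, map_dvd_iff]
  constructor
  · rintro ⟨w, rfl⟩
    simp
  · rintro ⟨⟨u, hu⟩, v, hv⟩
    exact ⟨⟨u, v⟩, by ext <;> simp [hu, hv]⟩

theorem QuadraticAlgebra.dvd_of_dvd_norm_of_dvd_trace {p : ℤ} (hp : Prime p)
    (hD : ¬ p ∣ b ^ 2 + 4 * a) {z : QuadraticAlgebra ℤ a b} (hn : p ∣ z.norm)
    (h₁ : p ∣ z.trace * z.re) (h₂ : p ∣ z.trace * z.im) : p ∣ z.re ∧ p ∣ z.im := by
  have ht : p ∣ z.trace := by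
    by_contra ht
    refine ht ?_
    rw [trace_def]
    exact dvd_add ((hp.dvd_or_dvd h₁).resolve_left ht |>.mul_left _)
      ((hp.dvd_or_dvd h₂).resolve_left ht |>.mul_left _)
  have him : p ∣ z.im := by
    have : p ∣ (b ^ 2 + 4 * a) * z.im ^ 2 := by
      have h : (b ^ 2 + 4 * a) * z.im ^ 2 = z.trace ^ 2 - 4 * z.norm := by
        rw [trace_def, four_mul_norm]; ring
      rw [h]
      exact dvd_sub (dvd_pow ht two_ne_zero) (hn.mul_left _)
    exact hp.dvd_of_dvd_pow ((hp.dvd_or_dvd this).resolve_left hD)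
  refine ⟨hp.dvd_of_dvd_pow (n := 2) ?_, him⟩
  have h : z.re ^ 2 = z.norm - (b * z.re - a * z.im) * z.im := by rw [norm_def]; ring
  rw [h]
  exact dvd_sub hn (him.mul_left _)

variable [IsDedekindDomain S] [Module.Free ℤ S] [Module.Finite ℤ S] [CharZero S]

omit [CharZero S] in
theorem ClassGroup.HasSqrtNat.prime_dvd_discr (e : QuadraticAlgebra ℤ a b ≃+* S)
    {c : ClassGroup S} {q : ℕ} (h : c.HasSqrtNat q) (hq : Squarefree q) {p : ℕ} (hp : p.Prime)
    (hpq : p ∣ q) : p ∣ (b ^ 2 + 4 * a).natAbs := by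
  obtain ⟨J, -, hJ⟩ := h
  have habs (n : ℕ) : absNorm (span {(n : S)}) = n ^ 2 := by
    rw [absNorm_span_singleton, ← map_natCast e, algebraNorm_ringEquiv, QuadraticAlgebra.norm_natCast]
    simp [Int.natAbs_pow]
  have hJq : absNorm (J : Ideal S) = q := by
    have := congrArg absNorm hJ
    rw [map_pow, habs] at this
    exact Nat.pow_left_injective two_ne_zero this
  by_contra hD
  rw [← Int.natCast_dvd] at hD
  have hle : (J : Ideal S) ≤ span {(p : S)} := by
    intro x hx
    obtain ⟨z, rfl⟩ := e.surjective x
    rw [mem_span_singleton, natCast_dvd_ringEquiv_iff]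
    have hqn : (q : ℤ) ∣ z.norm := by
      rw [← algebraNorm_ringEquiv e, Int.natCast_dvd, ← hJq, ← absNorm_span_singleton]
      exact map_dvd absNorm (dvd_span_singleton.2 hx)
    have hqx : (q : S) ∣ e (z.trace • z) := by
      have h₁ : e z ^ 2 ∈ span {(q : S)} := hJ ▸ pow_mem_pow hx 2
      have h₂ : (q : S) ∣ (z.norm : S) := by
        simpa using map_dvd (Int.castRingHom S) hqn
      have h₃ : e (z.trace • z) = e z ^ 2 + z.norm := by
        rw [map_zsmul, ← ringEquiv_mul_star, zsmul_eq_mul, ← ringEquiv_add_star]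
        ring
      rw [h₃]
      exact dvd_add (mem_span_singleton.1 h₁) h₂
    rw [natCast_dvd_ringEquiv_iff] at hqx
    have hpq' : (p : ℤ) ∣ q := mod_cast hpq
    exact dvd_of_dvd_norm_of_dvd_trace (Nat.prime_iff_prime_int.1 hp) hD (hpq'.trans hqn)
      (hpq'.trans hqx.1) (hpq'.trans hqx.2)
  have := map_dvd absNorm (dvd_iff_le.2 hle)
  rw [habs, hJq, sq] at this
  exact hp.one_lt.ne' (Nat.isUnit_iff.1 (hq p this))

omit [Module.Free ℤ S] [Module.Finite ℤ S] in
theorem ClassGroup.HasSqrtNat.exists_squarefree {c : ClassGroup S} {q : ℕ} (hq : q ≠ 0)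
    (h : c.HasSqrtNat q) : ∃ s, s ∣ q ∧ Squarefree s ∧ c.HasSqrtNat s := by
  obtain ⟨s, k, rfl, hs⟩ := Nat.sq_mul_squarefree q
  refine ⟨s, dvd_mul_left _ _, hs, HasSqrtNat.of_mul_sq (k := k) ?_ (by rwa [mul_comm])⟩
  rintro rfl
  simp at hq

theorem ClassGroup.card_sq_eq_one_le (e : QuadraticAlgebra ℤ a b ≃+* S) (hD : b ^ 2 + 4 * a < 0)
    (hsq : ¬ IsSquare (b ^ 2 + 4 * a).natAbs) :
    Nat.card {c : ClassGroup S // c ^ 2 = 1} ≤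
      2 ^ ((b ^ 2 + 4 * a).natAbs.primeFactors.card - 1) := by
  set D := b ^ 2 + 4 * a with hDdef
  have hD0 : D.natAbs ≠ 0 := by omega
  obtain ⟨s, k, hsk, hs⟩ := Nat.sq_mul_squarefree D.natAbs
  have hk0 : k ≠ 0 := by rintro rfl; simp at hsk; omega
  have hs1 : s ≠ 1 := by rintro rfl; exact hsq ⟨k, by rw [← hsk]; ring⟩
  obtain ⟨l, hl, s₁, rfl⟩ := Nat.exists_prime_and_dvd hs1
  have hls : ¬ l ∣ s₁ := fun h ↦ hl.one_lt.ne' (Nat.isUnit_iff.1 (hs l (mul_dvd_mul_left l h)))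
  have hlD : l ∈ D.natAbs.primeFactors := by
    rw [Nat.mem_primeFactors]
    exact ⟨hl, hsk ▸ (dvd_mul_right l s₁).mul_left _, hD0⟩
  let δ : QuadraticAlgebra ℤ a b := ⟨-b, 2⟩
  have hδ : e δ ^ 2 = (D : S) := by
    rw [← map_pow, ← map_intCast e]
    congr 1
    ext <;> simp [δ, sq, hDdef] <;> ring
  have hδ0 : e δ ≠ 0 := by
    rw [ne_eq, EmbeddingLike.map_eq_zero_iff]
    intro h
    simpa [δ] using congrArg QuadraticAlgebra.im h
  have key (c : {c : ClassGroup S // c ^ 2 = 1}) :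
      ∃ q, Squarefree q ∧ ¬ l ∣ q ∧ c.1.HasSqrtNat q := by
    obtain ⟨q₀, hq₀, h₀⟩ := ClassGroup.exists_hasSqrtNat e hD c.2
    obtain ⟨q, -, hq, h⟩ := h₀.exists_squarefree hq₀
    by_cases hlq : l ∣ q
    swap
    · exact ⟨q, hq, hlq, h⟩
    obtain ⟨q₁, rfl⟩ := hlq
    have hlq : ¬ l ∣ q₁ := fun h ↦
      hl.one_lt.ne' (Nat.isUnit_iff.1 (hq l (mul_dvd_mul_left l h)))
    have h' := h.mul_natAbs hδ0 hδ
    rw [← hsk, show l * q₁ * (k ^ 2 * (l * s₁)) = q₁ * s₁ * (l * k) ^ 2 by ring] at h'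
    have h₁ : ¬ l ∣ q₁ * s₁ := fun h ↦ (hl.dvd_mul.1 h).elim hlq hls
    obtain ⟨q', hdvd, hq', h''⟩ := (h'.of_mul_sq (mul_ne_zero hl.ne_zero hk0)).exists_squarefree
      (by rintro h; exact h₁ (h ▸ dvd_zero l))
    exact ⟨q', hq', fun h ↦ h₁ (h.trans hdvd), h''⟩
  choose q hq hlq h using key
  have hinj : Function.Injective (fun c ↦
      (⟨(q c).primeFactors, by
        rw [Finset.mem_powerset]
        intro p hp
        obtain ⟨hp, hpq, -⟩ := Nat.mem_primeFactors.1 hp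
        rw [Finset.mem_erase, Nat.mem_primeFactors]
        exact ⟨fun h ↦ hlq c (h ▸ hpq), hp, (h c).prime_dvd_discr e (hq c) hp hpq, hD0⟩⟩ :
        (D.natAbs.primeFactors.erase l).powerset)) := by
    intro c c' hcc
    have hcc' : (q c).primeFactors = (q c').primeFactors := congrArg Subtype.val hcc
    have : q c = q c' := by
      rw [← Nat.prod_primeFactors_of_squarefree (hq c), hcc',
        Nat.prod_primeFactors_of_squarefree (hq c')]
    exact Subtype.ext ((h c).unique (this ▸ h c'))
  refine (Nat.card_le_card_of_injective _ hinj).trans_eq ?_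
  rw [Nat.card_eq_fintype_card, Fintype.card_coe, Finset.card_powerset,
    Finset.card_erase_of_mem hlD]

end

section

theorem CommGroup.card_le_card_sq_eq_one_pow {G : Type*} [CommGroup G] [Finite G] (r : ℕ)
    (h : ∀ g : G, g ^ 2 ^ r = 1) : Nat.card G ≤ Nat.card {g : G // g ^ 2 = 1} ^ r := by
  induction r generalizing G with
  | zero =>
    have : Subsingleton G := ⟨fun x y ↦ by simpa using (h x).trans (h y).symm⟩
    simp
  | succ r ih =>
    let f : G →* G := powMonoidHom 2
    have h₁ : Nat.card f.ker = Nat.card {g : G // g ^ 2 = 1} :=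
      Nat.card_congr (Equiv.subtypeEquivRight fun g ↦ by simp [f, MonoidHom.mem_ker])
    have h₂ : Nat.card f.range ≤ Nat.card {g : f.range // g ^ 2 = 1} ^ r := by
      refine ih fun ⟨g, hg⟩ ↦ Subtype.ext ?_
      obtain ⟨x, rfl⟩ := hg
      simpa [f, ← pow_mul, ← pow_succ'] using h x
    have h₃ : Nat.card {g : f.range // g ^ 2 = 1} ≤ Nat.card {g : G // g ^ 2 = 1} := by
      refine Nat.card_le_card_of_injective
        (fun g ↦ ⟨g.1.1, by simpa using congrArg Subtype.val g.2⟩) fun g g' hg ↦ ?_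
      exact Subtype.ext (Subtype.ext (by simpa using hg))
    rw [← f.ker.card_mul_index, Subgroup.index_ker, h₁, pow_succ']
    exact Nat.mul_le_mul_left _ (h₂.trans (Nat.pow_le_pow_left h₃ r))

end

section

open NumberField

theorem primesProd_succ (n : ℕ) : primesProd (n + 1) = primesProd n * Nat.nth Nat.Prime n :=
  Finset.prod_range_succ _ _

theorem primesProd_pos (n : ℕ) : 0 < primesProd n :=
  Finset.prod_pos fun i _ ↦ (Nat.prime_nth_prime i).pos

theorem primesProd_mono : Monotone primesProd :=
  monotone_nat_of_le_succ fun n ↦ by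
    rw [primesProd_succ]
    exact Nat.le_mul_of_pos_right _ (Nat.prime_nth_prime n).pos

theorem primesProd_card_le_prod (s : Finset ℕ) (hs : ∀ p ∈ s, p.Prime) :
    primesProd s.card ≤ ∏ p ∈ s, p := by
  induction s using Finset.induction_on_max with
  | empty => simp [primesProd]
  | insert q s hq ih =>
    have hqs : q ∉ s := fun h ↦ (hq q h).false
    have hqp : q.Prime := hs q (Finset.mem_insert_self q s)
    rw [Finset.card_insert_of_notMem hqs, Finset.prod_insert hqs, primesProd_succ, mul_comm]
    refine Nat.mul_le_mul ?_ (ih fun p hp ↦ hs p (Finset.mem_insert_of_mem hp))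
    conv_rhs => rw [← Nat.nth_count hqp]
    refine Nat.nth_monotone Nat.infinite_setOfPred_prime ?_
    rw [Nat.count_eq_card_filter_range]
    refine Finset.card_le_card fun p hp ↦ ?_
    rw [Finset.mem_filter, Finset.mem_range]
    exact ⟨hq p hp, hs p (Finset.mem_insert_of_mem hp)⟩

theorem primesProd_card_primeFactors_le {n : ℕ} (hn : n ≠ 0) :
    primesProd n.primeFactors.card ≤ n :=
  (primesProd_card_le_prod _ fun _ ↦ Nat.prime_of_mem_primeFactors).trans
    (Nat.le_of_dvd (Nat.pos_of_ne_zero hn) (Nat.prod_primeFactors_dvd n))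

theorem Real.sqrt_div_log_mono {x y : ℝ} (hx : exp 2 ≤ x) (hxy : x ≤ y) :
    √x / log x ≤ √y / log y := by
  have h := log_div_sqrt_antitoneOn (Set.mem_ofPred_eq ▸ hx)
    (Set.mem_ofPred_eq ▸ hx.trans hxy) hxy
  have hy : 0 < y := (exp_pos 2).trans_le (hx.trans hxy)
  have hly : 0 < log y := by
    have : 2 ≤ log y := (le_log_iff_exp_le hy).2 (hx.trans hxy)
    linarith
  rw [← inv_div (log x), ← inv_div (log y)]
  exact inv_anti₀ (div_pos hly (sqrt_pos.2 hy)) h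

theorem Real.sqrt_div_log_mul_rpow_le {d p : ℝ} (hd : 1 < d) (hp : 1 < p) :
    √d / log d * p ^ (1 / 2 - 1 / log d : ℝ) ≤ √(d * p) / log (d * p) := by
  have hld : 0 < log d := log_pos hd
  have hlp : 0 < log p := log_pos hp
  have hp0 : 0 < p := by linarith
  have h₁ : p ^ (1 / 2 - 1 / log d : ℝ) = √p * exp (-(log p / log d)) := by
    rw [rpow_sub hp0, ← sqrt_eq_rpow, rpow_def_of_pos hp0 (1 / log d), exp_neg, div_eq_mul_inv √p,
      mul_one_div]
  have h₂ : exp (-(log p / log d)) ≤ log d / log (d * p) := by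
    rw [log_mul (zero_lt_one.trans hd).ne' hp0.ne', exp_neg, ← inv_div (log d + log p)]
    refine inv_anti₀ (by positivity) ?_
    have := add_one_le_exp (log p / log d)
    rwa [add_div, div_self hld.ne', add_comm]
  calc √d / log d * p ^ (1 / 2 - 1 / log d : ℝ)
      = √d / log d * √p * exp (-(log p / log d)) := by rw [h₁, mul_assoc]
    _ ≤ √d / log d * √p * (log d / log (d * p)) := by gcongr
    _ = √(d * p) / log (d * p) := by
      rw [sqrt_mul (by linarith)]
      field_simp

theorem two_pow_le_mul_sqrt_div_log_primesProd {r N : ℕ} {C : ℝ} (hC : 0 ≤ C)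
    (hN : 0 < N) (h1 : Real.exp 2 ≤ primesProd N)
    (h2 : (2 : ℝ) ^ r ≤
      (Nat.nth Nat.Prime (N - 1) : ℝ) ^ (1 / 2 - 1 / Real.log (primesProd N) : ℝ))
    (h3 : (2 : ℝ) ^ (r * (N - 1)) ≤ C * (√(primesProd N) / Real.log (primesProd N)))
    {n : ℕ} (hn : N ≤ n) :
    (2 : ℝ) ^ (r * (n - 1)) ≤ C * (√(primesProd n) / Real.log (primesProd n)) := by
  induction n, hn using Nat.le_induction with
  | base => exact h3
  | succ n hn ih =>
    have hd : Real.exp 2 ≤ primesProd n := h1.trans (mod_cast primesProd_mono hn)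
    have hlog (m : ℕ) (hm : Real.exp 2 ≤ primesProd m) : 2 ≤ Real.log (primesProd m) :=
      (Real.le_log_iff_exp_le (mod_cast primesProd_pos m)).2 hm
    have hd1 : (1 : ℝ) < primesProd n := by
      have := Real.add_one_le_exp 2
      linarith
    have hp (m : ℕ) : (1 : ℝ) < Nat.nth Nat.Prime m := mod_cast (Nat.prime_nth_prime m).one_lt
    have hpow : (2 : ℝ) ^ r ≤
        (Nat.nth Nat.Prime n : ℝ) ^ (1 / 2 - 1 / Real.log (primesProd n) : ℝ) := by
      have hN0 := hlog N h1
      have hexp : 0 ≤ 1 / 2 - 1 / Real.log (primesProd N) :=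
        sub_nonneg.2 (one_div_le_one_div_of_le two_pos hN0)
      refine h2.trans ((Real.rpow_le_rpow (zero_le_one.trans (hp _).le) ?_ hexp).trans
        (Real.rpow_le_rpow_of_exponent_le (hp n).le ?_))
      · exact_mod_cast Nat.nth_monotone Nat.infinite_setOfPred_prime (by omega)
      · have h₁ : (primesProd N : ℝ) ≤ primesProd n := mod_cast primesProd_mono hn
        have h₂ : (0 : ℝ) < primesProd N := mod_cast primesProd_pos N
        gcongr
    have hsucc : r * (n + 1 - 1) = r * (n - 1) + r := by
      obtain ⟨m, rfl⟩ := Nat.exists_eq_add_of_lt (hN.trans_le hn)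
      simp only [zero_add, Nat.add_sub_cancel]
      ring
    rw [hsucc, pow_add, primesProd_succ, Nat.cast_mul]
    calc (2 : ℝ) ^ (r * (n - 1)) * 2 ^ r
        ≤ C * (√(primesProd n) / Real.log (primesProd n)) *
            (Nat.nth Nat.Prime n : ℝ) ^ (1 / 2 - 1 / Real.log (primesProd n) : ℝ) := by
          gcongr
      _ ≤ _ := by
          rw [mul_assoc]
          gcongr
          exact Real.sqrt_div_log_mul_rpow_le hd1 (hp n)

theorem IsFundamentalDiscriminant.not_isSquare_natAbs {D : ℤ} (h : IsFundamentalDiscriminant D)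
    (hD : D < -4) : ¬ IsSquare D.natAbs := by
  rintro ⟨k, hk⟩
  have hk' : D = -(k * k) := by omega
  obtain ⟨-, ⟨hmod, hs⟩ | ⟨m, rfl, hs, hm⟩⟩ := h
  · have := Int.isUnit_iff.1 (hs k (hk' ▸ (dvd_refl _).neg_right))
    have : k = 1 := by omega
    subst this
    omega
  · have h2 : 2 ∣ k := by
      have : 2 ∣ k * k := by omega
      simpa using Nat.prime_two.dvd_mul.1 this
    obtain ⟨j, rfl⟩ := h2
    have hm' : m = -(j * j) := by push_cast at hk'; linarith
    have := Int.isUnit_iff.1 (hs j (hm' ▸ (dvd_refl _).neg_right))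
    have : j = 1 := by omega
    subst this
    omega

theorem NumberField.classNumber_le_two_pow {K : Type*} [Field K] [NumberField K]
    (hK : Module.finrank ℚ K = 2) (hD : discr K < 0) (hsq : ¬ IsSquare (discr K).natAbs) {r : ℕ}
    (h : ∀ c : ClassGroup (𝓞 K), c ^ 2 ^ r = 1) :
    classNumber K ≤ 2 ^ (r * ((discr K).natAbs.primeFactors.card - 1)) := by
  obtain ⟨a, b, ⟨e⟩, hab⟩ := exists_quadraticAlgebra_ringEquiv hK
  rw [hab] at hD hsq ⊢
  rw [classNumber, ← Nat.card_eq_fintype_card, mul_comm, pow_mul]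
  exact (CommGroup.card_le_card_sq_eq_one_pow r h).trans
    (Nat.pow_le_pow_left (ClassGroup.card_sq_eq_one_le e hD hsq) r)

end

theorem exponent_ne_two_pow_of_no_siegel_zero
    (r : ℕ) (hr : 1 ≤ r) (N : ℕ) (hN : 1 ≤ N)
    (h1 : Real.exp 11.2 ≤ (primesProd N : ℝ))
    (h2 : (2 : ℝ) ^ r ≤
      (Nat.nth Nat.Prime (N - 1) : ℝ) ^ ((1 : ℝ) / 2 - 1 / Real.log (primesProd N)))
    (h3 : (2 : ℝ) ^ (r * (N - 1)) ≤
      0.655 / (Real.pi * Real.exp 1) *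
        (Real.sqrt (primesProd N) / Real.log (primesProd N)))
    (D : ℤ) (hfund : IsFundamentalDiscriminant D) (hneg : D < 0)
    (hsize : (primesProd N : ℝ) ≤ |(D : ℝ)|)
    (χ : DirichletCharacter ℂ D.natAbs) (hχ : IsKroneckerChar D χ)
    (hnozero : ∀ s : ℝ, 1 - 1 / (4 * Real.log |(D : ℝ)|) ≤ s → s < 1 → LFunc χ (s : ℂ) ≠ 0) :
    ∀ (K : Type) [Field K] [NumberField K], Module.finrank ℚ K = 2 →
      NumberField.discr K = D →
        Monoid.exponent (ClassGroup (𝓞 K)) ≠ 2 ^ r := by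
  rintro K _ _ hK rfl hexp
  have hne : (discr K).natAbs ≠ 0 := by simpa using hneg.ne
  have : NeZero (discr K).natAbs := ⟨hne⟩
  have habs : |((discr K : ℤ) : ℝ)| = (discr K).natAbs := by rw [Nat.cast_natAbs, Int.cast_abs]
  rw [habs] at hsize hnozero
  have hlog : Real.exp 11.2 ≤ (discr K).natAbs := h1.trans hsize
  have hlow := hχ.lt_classNumber hK hneg hlog fun s hs hs1 ↦ by
    simpa [LFunc, hne] using hnozero s hs hs1
  have hexp2 : Real.exp 2 ≤ Real.exp 11.2 := Real.exp_le_exp.2 (by norm_num)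
  have hD4 : discr K < -4 := by
    have h := Real.add_one_le_exp 11.2
    have : (4 : ℝ) < (discr K).natAbs := by linarith
    have : 4 < (discr K).natAbs := mod_cast this
    omega
  have hup := NumberField.classNumber_le_two_pow hK hneg (hfund.not_isSquare_natAbs hD4)
    (r := r) fun c ↦ hexp ▸ Monoid.pow_exponent_eq_one c
  set n := (discr K).natAbs.primeFactors.card
  have hC : (0 : ℝ) ≤ 0.655 / (Real.pi * Real.exp 1) := by positivity
  have hup' : (classNumber K : ℝ) ≤ 2 ^ (r * (n - 1)) := mod_cast hup
  refine (hlow.trans_le hup').not_ge ?_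
  rcases le_total n N with hnN | hNn
  · refine (pow_le_pow_right₀ one_le_two (Nat.mul_le_mul_left r (Nat.sub_le_sub_right hnN 1))).trans
      (h3.trans (mul_le_mul_of_nonneg_left ?_ hC))
    exact Real.sqrt_div_log_mono (hexp2.trans h1) hsize
  · refine (two_pow_le_mul_sqrt_div_log_primesProd hC hN (hexp2.trans h1) h2 h3 hNn).trans
      (mul_le_mul_of_nonneg_left ?_ hC)
    exact Real.sqrt_div_log_mono
      (hexp2.trans (h1.trans (mod_cast primesProd_mono hNn)))
      (mod_cast primesProd_card_primeFactors_le hne)
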